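/- arXiv:2009.05022 — 6 statements merged into one kernel-verified Lean document; each statement's English description precedes it below -/
import Mathlib

section
/- Let R = k[x_0,…,x_N] be a standard graded polynomial ring over a field k with maximal homogeneous ideal 𝔪, and let I ⊆ R be a homogeneous radical ideal of big height h (every associated prime of R/I has height at most h, and at least one has height exactly h). Fix an integer m ≥ 1 and suppose there exists an integer c ≥ 1 such that I^{(c(h+m−1)−h+1)} ⊆ 𝔪^{c(h−1)} · (I^{(m)})^c. Then for every n ≥ 1 one has (m+h−1) · α(I^{(n)}) ≥ n · (α(I^{(m)}) + h − 1); equivalently the Waldschmidt constant \widehat{α}(I) = inf_{n≥1} α(I^{(n)})/n satisfies \widehat{α}(I) ≥ (α(I^{(m)}) + h − 1)/(m + h − 1). -/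
/-- The `n`-th symbolic power of an ideal `I`:
`f ∈ I^{(n)}` iff for every associated prime `P` of `R/I` there is `s ∉ P` with `s*f ∈ I^n`. -/
def symbolicPower {R : Type*} [CommRing R] (I : Ideal R) (n : ℕ) : Ideal R where
  carrier := {f | ∀ P ∈ associatedPrimes R (R ⧸ I), ∃ s, s ∉ P ∧ s * f ∈ I ^ n}
  zero_mem' := by
    intro P hP
    exact ⟨1, fun h => hP.1.ne_top ((Ideal.eq_top_iff_one P).mpr h), by
      simp⟩
  add_mem' := by
    intro a b ha hb P hP
    obtain ⟨s, hs, hsa⟩ := ha P hP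
    obtain ⟨t, ht, htb⟩ := hb P hP
    refine ⟨s * t, fun h => ((hP.1.mem_or_mem h).elim hs ht), ?_⟩
    have heq : s * t * (a + b) = t * (s * a) + s * (t * b) := by ring
    rw [heq]
    exact Ideal.add_mem _ (Ideal.mul_mem_left _ _ hsa) (Ideal.mul_mem_left _ _ htb)
  smul_mem' := by
    intro r a ha P hP
    obtain ⟨s, hs, hsa⟩ := ha P hP
    refine ⟨s, hs, ?_⟩
    have heq : s * (r • a) = r * (s * a) := by rw [smul_eq_mul]; ring
    rw [heq]
    exact Ideal.mul_mem_left _ _ hsa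

/-- `α(J)`: the least degree of a nonzero homogeneous element of `J`. -/
noncomputable def alphaDeg {k : Type*} [CommSemiring k] {σ : Type*}
    (J : Ideal (MvPolynomial σ k)) : ℕ :=
  sInf {d | ∃ f ∈ J, f ≠ 0 ∧ MvPolynomial.IsHomogeneous f d}

open MvPolynomial

theorem Int.isJacobsonRing : IsJacobsonRing ℤ := by
  rw [isJacobsonRing_iff_prime_eq]
  intro P hP
  by_cases h0 : P = ⊥
  · subst h0
    refine le_antisymm (fun x hx => ?_) Ideal.le_jacobson
    have h := Ideal.mem_jacobson_bot.mp hx x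
    rw [Int.isUnit_iff] at h
    rw [Ideal.mem_bot]
    rcases h with h | h <;> nlinarith [mul_self_nonneg x]
  · have := IsPrime.to_maximal_ideal h0
    exact Ideal.jacobson_eq_self_of_isMaximal

theorem exists_charP_of_surjective_of_finiteType_int {A K : Type*} [CommRing A]
    [Algebra.FiniteType ℤ A] [Field K] (f : A →+* K) (hf : Function.Surjective f) :
    ∃ p : ℕ, p.Prime ∧ CharP K p := by
  have := Int.isJacobsonRing
  have : Algebra.FiniteType ℤ K := .of_surjective f.toIntAlgHom hf
  have hfin : Module.Finite ℤ K := finite_of_finite_type_of_isJacobsonRing ℤ K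
  obtain ⟨p, hp⟩ := CharP.exists K
  rcases CharP.char_is_prime_or_zero K p with h | rfl
  · exact ⟨p, h, hp⟩
  have := CharP.charP_to_charZero K
  have hint : IsIntegral ℤ (algebraMap ℚ K (1 / 2)) := Algebra.IsIntegral.isIntegral _
  rw [isIntegral_algebraMap_iff (algebraMap ℚ K).injective,
    IsIntegrallyClosed.isIntegral_iff] at hint
  obtain ⟨y, hy⟩ := hint
  have h2 : ((2 * y : ℤ) : ℚ) = (1 : ℤ) := by
    push_cast
    rw [show (y : ℚ) = 1 / 2 from hy]
    norm_num
  have := Int.cast_injective h2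
  omega

universe u

theorem exists_perfect_charP_ringHom (A : Type u) [CommRing A] [Nontrivial A]
    [Algebra.FiniteType ℤ A] :
    ∃ (L : Type u) (_ : Field L) (p : ℕ) (_ : Fact p.Prime) (_ : CharP L p) (_ : PerfectRing L p),
      Nonempty (A →+* L) := by
  obtain ⟨m, hm⟩ := Ideal.exists_maximal A
  let := Ideal.Quotient.field m
  obtain ⟨p, hp, hc⟩ :=
    exists_charP_of_surjective_of_finiteType_int _ (Ideal.Quotient.mk_surjective (I := m))
  have := Fact.mk hp
  have : CharP (AlgebraicClosure (A ⧸ m)) p :=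
    charP_of_injective_algebraMap (algebraMap (A ⧸ m) _).injective p
  exact ⟨AlgebraicClosure (A ⧸ m), inferInstance, p, ⟨hp⟩, inferInstance, inferInstance,
    ⟨(algebraMap (A ⧸ m) _).comp (Ideal.Quotient.mk m)⟩⟩

theorem exists_functional_of_injective {K σ ι : Type*} [Field K] [Fintype ι]
    (J : ι → Ideal (MvPolynomial σ K))
    (hJ : ∀ i, ∀ f ∈ J i, ∀ d, homogeneousComponent d f ∈ J i)
    (u : ι → MvPolynomial σ K) (E : ι → ℕ) (hu : ∀ i, (u i).IsHomogeneous (E i)) (D : ℕ)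
    (hinj : ∀ G : MvPolynomial σ K, G.IsHomogeneous D → (∀ i, u i * G ∈ J i) → G = 0)
    (T : ι → Finset (σ →₀ ℕ)) (hT : ∀ i ν, ν ∈ T i ↔ ν.degree = E i + D) (μ : σ →₀ ℕ) :
    ∃ θ : ι → (σ →₀ ℕ) → K,
      (∀ i, ∀ f ∈ J i, ∑ ν ∈ T i, θ i ν * coeff ν f = 0) ∧
      ∀ G : MvPolynomial σ K, G.IsHomogeneous D →
        ∑ i, ∑ ν ∈ T i, θ i ν * coeff ν (u i * G) = coeff μ G := by
  classical
  let Φ : MvPolynomial σ K →ₗ[K] (∀ i, MvPolynomial σ K ⧸ J i) :=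
    LinearMap.pi fun i => (Ideal.Quotient.mkₐ K (J i)).toLinearMap ∘ₗ LinearMap.mulLeft K (u i)
  have hΦ : Function.Injective (Φ ∘ₗ (homogeneousSubmodule σ K D).subtype) := by
    rw [← LinearMap.ker_eq_bot, LinearMap.ker_eq_bot']
    rintro ⟨G, hG⟩ h
    have := hinj G hG fun i => Ideal.Quotient.eq_zero_iff_mem.mp (congrFun h i)
    simpa using this
  obtain ⟨Θ, hΘ⟩ := LinearMap.dualMap_surjective_of_injective hΦ
    (lcoeff K μ ∘ₗ (homogeneousSubmodule σ K D).subtype)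
  let q : ∀ i, MvPolynomial σ K →ₗ[K] K := fun i =>
    Θ ∘ₗ LinearMap.single K _ i ∘ₗ (Ideal.Quotient.mkₐ K (J i)).toLinearMap
  have key : ∀ i f, ∑ ν ∈ T i, q i (monomial ν 1) * coeff ν f
      = q i (homogeneousComponent (E i + D) f) := by
    intro i f
    have : homogeneousComponent (E i + D) f
        = ∑ ν ∈ T i, coeff ν f • monomial ν (1 : K) := by
      ext ν
      simp [coeff_homogeneousComponent, coeff_sum, coeff_monomial, hT]
    rw [this, map_sum]
    simp [mul_comm]
  refine ⟨fun i ν => q i (monomial ν 1), fun i f hf => ?_, fun G hG => ?_⟩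
  · rw [key]
    have : Ideal.Quotient.mk (J i) (homogeneousComponent (E i + D) f) = 0 :=
      Ideal.Quotient.eq_zero_iff_mem.mpr (hJ i f hf _)
    simp [q, this]
  · have h1 : ∀ i, ∑ ν ∈ T i, q i (monomial ν 1) * coeff ν (u i * G) = q i (u i * G) := by
      intro i
      rw [key, homogeneousComponent_eq_self ((hu i).mul hG)]
    have h2 := LinearMap.congr_fun hΘ ⟨G, hG⟩
    simp only [h1]
    have h3 : ∑ i, q i (u i * G) = Θ (Φ G) := by
      simp only [q, LinearMap.comp_apply]
      rw [← map_sum]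
      congr 1
      exact LinearMap.sum_single_apply _ _
    rw [h3]
    exact h2

/-- For exponents `α` with all entries below `q`, the additive map extracting from a polynomial
the part supported on exponents `α + q • γ`, reindexed by `γ` and with coefficients transformed
by `φ`. -/
noncomputable def cartierMap {L σ : Type*} [CommSemiring L] (φ : L →+ L) {q : ℕ} (hq : 0 < q)
    (α : σ →₀ ℕ) : MvPolynomial σ L →+ MvPolynomial σ L where
  toFun f := .ofCoeff (Finsupp.mapRange φ (map_zero φ)
    (Finsupp.comapDomain (fun γ : σ →₀ ℕ => α + q • γ) (AddMonoidAlgebra.coeff f)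
      (fun γ _ δ _ h => by
        ext i
        have := DFunLike.congr_fun h i
        simpa [hq.ne'] using this)))
  map_zero' := by
    ext γ
    exact map_zero φ
  map_add' f g := by
    ext γ
    exact map_add φ _ _

section Cartier

variable {L σ : Type*}

theorem coeff_cartierMap [CommSemiring L] (φ : L →+ L) {q : ℕ} (hq : 0 < q) (α γ : σ →₀ ℕ)
    (f : MvPolynomial σ L) : coeff γ (cartierMap φ hq α f) = φ (coeff (α + q • γ) f) := rfl

theorem cartierMap_pow_mul [CommRing L] (p e : ℕ) [ExpChar L p] (φ : L →+ L)
    (hq : 0 < p ^ e) (hφ : ∀ a b, φ (a ^ p ^ e * b) = a * φ b)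
    {α : σ →₀ ℕ} (hα : ∀ i, α i < p ^ e) (u f : MvPolynomial σ L) :
    cartierMap φ hq α (u ^ p ^ e * f) = u * cartierMap φ hq α f := by
  classical
  induction u using MvPolynomial.induction_on' with
  | add u v hu hv => rw [add_pow_expChar_pow, add_mul, map_add, hu, hv, add_mul]
  | monomial m a =>
    ext γ
    rw [coeff_cartierMap, monomial_pow, coeff_monomial_mul', coeff_monomial_mul', coeff_cartierMap]
    have hle : p ^ e • m ≤ α + p ^ e • γ ↔ m ≤ γ := by
      simp only [Finsupp.le_def, Finsupp.add_apply, Finsupp.smul_apply, smul_eq_mul]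
      refine forall_congr' fun i => ⟨fun h => ?_, fun h => ?_⟩
      · by_contra! hlt
        have := Nat.mul_le_mul_left (p ^ e) hlt
        have := hα i
        rw [Nat.mul_add_one] at *
        omega
      · exact (Nat.mul_le_mul_left _ h).trans (Nat.le_add_left _ _)
    by_cases h : m ≤ γ
    · rw [if_pos (hle.mpr h), if_pos h, hφ]
      congr 3
      ext i
      simp [Nat.mul_sub, Nat.add_sub_assoc (Nat.mul_le_mul_left (p ^ e) (h i))]
    · rw [if_neg (mt hle.mp h), if_neg h, map_zero]

theorem cartierMap_mem [CommRing L] (p e : ℕ) [ExpChar L p] (φ : L →+ L)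
    (hq : 0 < p ^ e) (hφ : ∀ a b, φ (a ^ p ^ e * b) = a * φ b)
    {α : σ →₀ ℕ} (hα : ∀ i, α i < p ^ e) {J : Ideal (MvPolynomial σ L)} {f : MvPolynomial σ L}
    (hf : f ∈ J.map (iterateFrobenius (MvPolynomial σ L) p e)) :
    cartierMap φ hq α f ∈ J := by
  suffices h : ∀ r, cartierMap φ hq α (r * f) ∈ J by simpa using h 1
  rw [Ideal.map] at hf
  induction hf using Submodule.span_induction with
  | mem x hx =>
    obtain ⟨j, hj, rfl⟩ := hx
    intro r
    rw [iterateFrobenius_def, mul_comm r, cartierMap_pow_mul p e φ hq hφ hα]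
    exact J.mul_mem_right _ hj
  | zero => simp
  | add x y _ _ hx hy =>
    intro r
    rw [mul_add, map_add]
    exact J.add_mem (hx r) (hy r)
  | smul t x _ hx =>
    intro r
    rw [smul_eq_mul, ← mul_assoc]
    exact hx _

end Cartier

/-- With `q = p ^ e`: if `k ≥ s * q + (h - 1) * (q - 1)`, then a product of `k` elements of an
`h`-element set is a multiple of the `q`-th power of a product of `s` of them. -/
theorem Ideal.span_range_pow_le_map_iterateFrobenius {R : Type*} [CommRing R] (p e : ℕ)
    [ExpChar R p] {h : ℕ} (g : Fin h → R) (s k : ℕ)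
    (hk : s * p ^ e + h * (p ^ e - 1) ≤ k + (p ^ e - 1)) :
    Ideal.span (Set.range g) ^ k ≤
      (Ideal.span (Set.range g) ^ s).map (iterateFrobenius R p e) := by
  intro x hx
  obtain ⟨P, hP, rfl⟩ := (Ideal.mem_span_pow_iff_exists_isHomogeneous g x).mp hx
  rw [eval_eq']
  refine Ideal.sum_mem _ fun β hβ => Ideal.mul_mem_left _ _ ?_
  have hdeg : ∑ i, β i = k := by
    rw [← Finsupp.degree_eq_sum]
    exact (hP.degree_eq_sum_deg_support hβ).symm
  have hq : 0 < p ^ e := pow_pos (expChar_pos R p) e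
  have hs : s ≤ ∑ i, β i / p ^ e := by
    by_contra! hlt
    have h1 : ∑ i, β i ≤ ∑ i, (p ^ e * (β i / p ^ e) + (p ^ e - 1)) :=
      Finset.sum_le_sum fun i _ => by
        have := Nat.div_add_mod (β i) (p ^ e)
        have := Nat.mod_lt (β i) hq
        omega
    rw [Finset.sum_add_distrib, ← Finset.mul_sum] at h1
    simp only [Finset.sum_const, Finset.card_univ, Fintype.card_fin, smul_eq_mul] at h1
    have h2 := Nat.mul_le_mul_left (p ^ e) hlt
    rw [Nat.mul_succ] at h2
    have := mul_comm s (p ^ e)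
    omega
  have hsplit : ∏ i, g i ^ β i =
      (∏ i, g i ^ (β i % p ^ e)) * iterateFrobenius R p e (∏ i, g i ^ (β i / p ^ e)) := by
    rw [iterateFrobenius_def, ← Finset.prod_pow, ← Finset.prod_mul_distrib]
    refine Finset.prod_congr rfl fun i _ => ?_
    rw [← pow_mul, ← pow_add, mul_comm (β i / p ^ e), Nat.mod_add_div]
  rw [hsplit]
  refine Ideal.mul_mem_left _ _ (Ideal.mem_map_of_mem _ (Ideal.pow_le_pow_right hs ?_))
  rw [← Finset.prod_pow_eq_pow_sum]
  exact Ideal.prod_mem_prod fun i _ =>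
    Ideal.pow_mem_pow (Ideal.subset_span (Set.mem_range_self i)) _

theorem exists_isHomogeneous_pow_mul_mem_span_pow_of_charP {L σ ι : Type*} [Field L] [Nonempty σ]
    (p : ℕ) [Fact p.Prime] [CharP L p] [PerfectRing L p] {h n s d a : ℕ} (hh : 0 < h) (hn : 0 < n)
    (hlt : d * (s + h - 1) < n * a)
    {F : MvPolynomial σ L} (hF0 : F ≠ 0) (hF : F.IsHomogeneous d)
    (w : ι → MvPolynomial σ L) (g : ι → Fin h → MvPolynomial σ L)
    (hmem : ∀ i, w i * F ∈ Ideal.span (Set.range (g i)) ^ n) :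
    ∃ G : MvPolynomial σ L, G ≠ 0 ∧ G.IsHomogeneous (a - 1) ∧
      ∀ i, w i ^ (s + h) * G ∈ Ideal.span (Set.range (g i)) ^ s := by
  classical
  obtain ⟨e, he⟩ : ∃ e, d * n < p ^ e :=
    ⟨d * n, Nat.lt_pow_self (Fact.out : p.Prime).one_lt⟩
  have hq : 0 < p ^ e := pow_pos (Fact.out : p.Prime).pos e
  let φ : L →+ L := ((iterateFrobeniusEquiv L p e).symm : L →+* L)
  have hφ : ∀ a b, φ (a ^ p ^ e * b) = a * φ b := by
    intro a b
    change (iterateFrobeniusEquiv L p e).symm _ = a * (iterateFrobeniusEquiv L p e).symm b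
    rw [map_mul, ← iterateFrobenius_def, ← iterateFrobeniusEquiv_apply, RingEquiv.symm_apply_apply]
  have hφ0 : ∀ x, φ x = 0 → x = 0 := fun x hx =>
    (map_eq_zero_iff _ (iterateFrobeniusEquiv L p e).symm.injective).mp hx
  obtain ⟨h, rfl⟩ : ∃ h', h = h' + 1 := ⟨h - 1, by omega⟩
  simp only [← add_assoc, Nat.add_sub_cancel] at *
  set q := p ^ e with hqdef
  set b := (s + h) * q / n + 1 with hb
  have hb1 : (s + h) * q ≤ n * b := by
    have := Nat.div_add_mod ((s + h) * q) n
    have := Nat.mod_lt ((s + h) * q) hn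
    rw [hb, Nat.mul_add_one]
    omega
  have hb2 : n * b ≤ (s + h) * q + n := by
    have := Nat.mul_div_le ((s + h) * q) n
    rw [hb, Nat.mul_add_one]
    omega
  have hb3 : b ≤ (s + h + 1) * q := by
    have := Nat.div_le_self ((s + h) * q) n
    rw [hb, Nat.add_one_mul]
    omega
  have hFb : F ^ b ≠ 0 := pow_ne_zero _ hF0
  obtain ⟨ν, hν⟩ := MvPolynomial.ne_zero_iff.mp hFb
  let α : σ →₀ ℕ := ν.mapRange (· % q) (Nat.zero_mod q)
  let γ : σ →₀ ℕ := ν.mapRange (· / q) (Nat.zero_div q)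
  have hα : ∀ i, α i < q := fun i => Nat.mod_lt _ hq
  have hαγ : α + q • γ = ν := by
    ext i
    simpa [α, γ] using Nat.mod_add_div (ν i) q
  let G := cartierMap φ hq α (F ^ b)
  have hcoeff : ∀ δ, coeff δ G ≠ 0 → α.degree + q * δ.degree = d * b := by
    intro δ hδ
    have h1 : coeff (α + q • δ) (F ^ b) ≠ 0 := fun h0 => hδ (by
      rw [coeff_cartierMap, h0, map_zero])
    have h2 : d * b = (α + q • δ).degree :=
      (hF.pow b).degree_eq_sum_deg_support (mem_support_iff.mpr h1)
    rw [h2, map_add, map_nsmul, smul_eq_mul]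
  have hγ : coeff γ G ≠ 0 := by
    intro h0
    rw [coeff_cartierMap, hαγ] at h0
    exact hν (hφ0 _ h0)
  have hG0 : G ≠ 0 := MvPolynomial.ne_zero_iff.mpr ⟨γ, hγ⟩
  have hG : G.IsHomogeneous γ.degree := by
    intro δ hδ
    have h1 := hcoeff δ hδ
    have h2 := hcoeff γ hγ
    have h3 : δ.degree = γ.degree := Nat.eq_of_mul_eq_mul_left hq (by omega)
    rw [← h3, Finsupp.degree_eq_weight_one]
    rfl
  have hdeg : γ.degree < a := by
    have h1 := hcoeff γ hγ
    have h2 : q * γ.degree ≤ d * b := by omega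
    by_contra! hle
    have h3 : n * (q * γ.degree) ≤ d * (n * b) := by nlinarith
    have h4 : d * (n * b) ≤ d * ((s + h) * q + n) := Nat.mul_le_mul_left _ hb2
    have h5 : n * (q * a) ≤ n * (q * γ.degree) := by gcongr
    have h6 : (d * (s + h) + 1) * q ≤ n * a * q := Nat.mul_le_mul_right _ hlt
    nlinarith
  have hGmem : ∀ i, w i ^ (s + h + 1) * G ∈ Ideal.span (Set.range (g i)) ^ s := by
    intro i
    rw [← cartierMap_pow_mul p e φ hq hφ hα]
    refine cartierMap_mem p e φ hq hφ hα
      (Ideal.span_range_pow_le_map_iterateFrobenius p e (g i) s (n * b) ?_ ?_)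
    · rw [← hqdef]
      have h1 : (h + 1) * (q - 1) ≤ h * q + (q - 1) := by
        rw [Nat.add_one_mul]
        gcongr
        omega
      nlinarith
    · rw [← pow_mul, ← hqdef, ← Nat.sub_add_cancel hb3, pow_add, mul_assoc, ← mul_pow, pow_mul]
      exact Ideal.mul_mem_left _ _ (Ideal.pow_mem_pow (hmem i) b)
  obtain ⟨x⟩ := ‹Nonempty σ›
  refine ⟨X x ^ (a - 1 - γ.degree) * G, mul_ne_zero (pow_ne_zero _ (X_ne_zero x)) hG0, ?_,
    fun i => ?_⟩
  · convert (isHomogeneous_X_pow x _).mul hG using 1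
    omega
  · rw [mul_left_comm]
    exact Ideal.mul_mem_left _ _ (hGmem i)

theorem coeff_eq_zero_of_functional {A L σ ι : Type*} [CommRing A] [CommRing L] [Fintype ι]
    (ψ : A →+* L) (J : ι → Ideal (MvPolynomial σ A)) (u : ι → MvPolynomial σ A) (D : ℕ)
    (T : ι → Finset (σ →₀ ℕ)) (θ : ι → (σ →₀ ℕ) → A) (μ : σ →₀ ℕ)
    (hJ : ∀ i, ∀ f ∈ J i, ∑ ν ∈ T i, θ i ν * coeff ν f = 0)
    (hu : ∀ δ : σ →₀ ℕ, δ.degree = D →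
      ∑ i, ∑ ν ∈ T i, θ i ν * coeff ν (u i * monomial δ 1) = coeff μ (monomial δ 1))
    {G : MvPolynomial σ L} (hG : G.IsHomogeneous D)
    (hmem : ∀ i, map ψ (u i) * G ∈ (J i).map (map ψ)) : coeff μ G = 0 := by
  classical
  let Λ : ι → MvPolynomial σ L →ₗ[L] L := fun i => ∑ ν ∈ T i, ψ (θ i ν) • lcoeff L ν
  have hΛ : ∀ i f, Λ i (map ψ f) = ψ (∑ ν ∈ T i, θ i ν * coeff ν f) := by
    intro i f
    simp [Λ, coeff_map]
  have hΛJ : ∀ i, ∀ f ∈ (J i).map (map ψ), ∀ r, Λ i (r * f) = 0 := by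
    intro i f hf
    rw [Ideal.map] at hf
    induction hf using Submodule.span_induction with
    | mem x hx =>
      obtain ⟨f, hf, rfl⟩ := hx
      intro r
      induction r using MvPolynomial.induction_on' with
      | monomial m c =>
        have : monomial m c * map ψ f = c • map ψ (monomial m 1 * f) := by
          simp [← smul_mul_assoc, smul_monomial]
        rw [this, map_smul, hΛ, hJ i _ ((J i).mul_mem_left _ hf), map_zero, smul_zero]
      | add p q hp hq => rw [add_mul, map_add, hp, hq, add_zero]
    | zero => simp
    | add x y _ _ hx hy =>
      intro r
      rw [mul_add, map_add, hx, hy, add_zero]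
    | smul t x _ hx =>
      intro r
      rw [smul_eq_mul, ← mul_assoc]
      exact hx _
  have hsum : ∑ i, Λ i (map ψ (u i) * G) = coeff μ G := by
    have hGs : G = ∑ δ ∈ G.support, coeff δ G • map ψ (monomial δ 1) := by
      conv_lhs => rw [G.as_sum]
      simp [smul_monomial]
    have h1 : ∀ i, Λ i (map ψ (u i) * G) =
        ∑ δ ∈ G.support, coeff δ G * ψ (∑ ν ∈ T i, θ i ν * coeff ν (u i * monomial δ 1)) := by
      intro i
      conv_lhs => rw [hGs]
      rw [Finset.mul_sum, map_sum]
      refine Finset.sum_congr rfl fun δ _ => ?_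
      rw [mul_smul_comm, map_smul, ← map_mul, hΛ, smul_eq_mul]
    simp only [h1]
    rw [Finset.sum_comm]
    conv_rhs => rw [hGs]
    rw [coeff_sum]
    refine Finset.sum_congr rfl fun δ hδ => ?_
    rw [← Finset.mul_sum, ← map_sum, hu δ (hG.degree_eq_sum_deg_support hδ).symm, coeff_smul,
      coeff_map, smul_eq_mul]
  rw [← hsum]
  exact Finset.sum_eq_zero fun i _ => by simpa using hΛJ i _ (hmem i) 1

theorem homogeneousComponent_mem_span_range_pow {K σ κ : Type*} [CommRing K]
    {g : κ → MvPolynomial σ K} {δ : κ → ℕ} (hg : ∀ j, (g j).IsHomogeneous (δ j)) (s : ℕ)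
    {f : MvPolynomial σ K} (hf : f ∈ Ideal.span (Set.range g) ^ s) (d : ℕ) :
    homogeneousComponent d f ∈ Ideal.span (Set.range g) ^ s := by
  let _ : GradedAlgebra (homogeneousSubmodule σ K) := MvPolynomial.gradedAlgebra
  have h1 : (Ideal.span (Set.range g)).IsHomogeneous (homogeneousSubmodule σ K) := by
    refine Ideal.homogeneous_span _ _ ?_
    rintro _ ⟨j, rfl⟩
    exact ⟨δ j, hg j⟩
  have h2 : (Ideal.span (Set.range g) ^ s).IsHomogeneous (homogeneousSubmodule σ K) := by
    clear hf
    induction s with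
    | zero => simpa using Ideal.IsHomogeneous.top _
    | succ s ih =>
      rw [pow_succ]
      exact ih.mul h1
  exact homogeneousComponent_mem_of_mem h2 hf d

theorem exists_map_eq_of_coeffs_subset {K σ : Type*} [CommRing K] (A : Subalgebra ℤ K)
    {f : MvPolynomial σ K} (hf : (f.coeffs : Set K) ⊆ A) :
    ∃ f' : MvPolynomial σ A, map (algebraMap A K) f' = f :=
  mem_range_map_iff_coeffs_subset.mpr (by simpa using hf)

theorem exists_finset_descent_mem_span_range_pow {K σ κ : Type*} [CommRing K]
    {g : κ → MvPolynomial σ K} {n : ℕ} {f : MvPolynomial σ K}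
    (hf : f ∈ Ideal.span (Set.range g) ^ n) :
    ∃ Z : Finset K, ∀ A : Subalgebra ℤ K, (Z : Set K) ⊆ A →
      ∀ (g' : κ → MvPolynomial σ A) (f' : MvPolynomial σ A),
        (∀ j, map (algebraMap A K) (g' j) = g j) → map (algebraMap A K) f' = f →
          f' ∈ Ideal.span (Set.range g') ^ n := by
  classical
  obtain ⟨P, hP, hPf⟩ := (Ideal.mem_span_pow_iff_exists_isHomogeneous g f).mp hf
  refine ⟨P.coeffs.biUnion fun c => c.coeffs, fun A hA g' f' hg hf' => ?_⟩
  have hinj : Function.Injective (map (σ := σ) (algebraMap A K)) :=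
    map_injective _ Subtype.val_injective
  obtain ⟨P', rfl⟩ : P ∈ Set.range (map (σ := κ) (map (σ := σ) (algebraMap A K))) := by
    rw [mem_range_map_iff_coeffs_subset]
    intro c hc
    exact exists_map_eq_of_coeffs_subset A fun x hx =>
      hA (Finset.mem_coe.mpr (Finset.mem_biUnion.mpr ⟨c, hc, hx⟩))
  refine (Ideal.mem_span_pow_iff_exists_isHomogeneous g' f').mpr ⟨P', .of_map hinj hP, hinj ?_⟩
  rw [hf', ← hPf, ← funext hg, map_eval]
  rfl

theorem map_mem_span_range_pow {A L σ κ : Type*} [CommRing A] [CommRing L] (ψ : A →+* L)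
    {g : κ → MvPolynomial σ A} {n : ℕ} {f : MvPolynomial σ A}
    (hf : f ∈ Ideal.span (Set.range g) ^ n) :
    map ψ f ∈ Ideal.span (Set.range fun j => map ψ (g j)) ^ n := by
  have := Ideal.mem_map_of_mem (map ψ) hf
  rwa [Ideal.map_pow, Ideal.map_span, ← Set.range_comp] at this

theorem exists_isHomogeneous_pow_mul_mem_span_pow {K σ ι : Type*} [Field K] [Finite σ]
    [Nonempty σ] [Finite ι] {h n s d a : ℕ} (hh : 0 < h) (hn : 0 < n)
    (hlt : d * (s + h - 1) < n * a)
    {F : MvPolynomial σ K} (hF0 : F ≠ 0) (hF : F.IsHomogeneous d)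
    (w : ι → MvPolynomial σ K) (e : ι → ℕ) (hw : ∀ i, (w i).IsHomogeneous (e i))
    (g : ι → Fin h → MvPolynomial σ K) (δ : ι → Fin h → ℕ)
    (hg : ∀ i j, (g i j).IsHomogeneous (δ i j))
    (hmem : ∀ i, w i * F ∈ Ideal.span (Set.range (g i)) ^ n) :
    ∃ G : MvPolynomial σ K, G ≠ 0 ∧ G.IsHomogeneous (a - 1) ∧
      ∀ i, w i ^ (s + h) * G ∈ Ideal.span (Set.range (g i)) ^ s := by
  classical
  have := Fintype.ofFinite ι
  by_contra! hcon
  let T : ℕ → Finset (σ →₀ ℕ) := fun D => (Finsupp.finite_of_degree_eq (σ := σ) D).toFinset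
  have hT : ∀ D ν, ν ∈ T D ↔ ν.degree = D := fun D ν => by simp [T]
  have hfun := exists_functional_of_injective
    (fun i => Ideal.span (Set.range (g i)) ^ s)
    (fun i f hf => homogeneousComponent_mem_span_range_pow (hg i) s hf) (fun i => w i ^ (s + h))
    (fun i => e i * (s + h)) (fun i => (hw i).pow _) (a - 1)
    (fun G hG hGm => by
      by_contra hG0
      obtain ⟨i, hi⟩ := hcon G hG0 hG
      exact hi (hGm i)) (fun i => T (e i * (s + h) + (a - 1))) (fun i ν => hT _ ν)
  choose θ hθJ hθ using hfun
  choose ZP hZP using fun i => exists_finset_descent_mem_span_range_pow (hmem i)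
  obtain ⟨μF, hμF⟩ := ne_zero_iff.mp hF0
  let Z : Finset K := F.coeffs ∪ {(coeff μF F)⁻¹} ∪ Finset.univ.biUnion (fun i => (w i).coeffs) ∪
    Finset.univ.biUnion (fun i => Finset.univ.biUnion fun j => (g i j).coeffs) ∪
    Finset.univ.biUnion ZP ∪
    (T (a - 1)).biUnion (fun μ => Finset.univ.biUnion fun i =>
      (T (e i * (s + h) + (a - 1))).image (θ μ i))
  let A : Subalgebra ℤ K := Algebra.adjoin ℤ (Z : Set K)
  have hZA : ∀ z ∈ Z, z ∈ A := fun z hz => Algebra.subset_adjoin hz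
  have : Algebra.FiniteType ℤ A :=
    (Subalgebra.fg_iff_finiteType _).mp (Subalgebra.fg_adjoin_finset Z)
  have hinj : Function.Injective (map (σ := σ) (algebraMap A K)) :=
    map_injective _ Subtype.val_injective
  obtain ⟨F', hF'⟩ : ∃ F', map (algebraMap A K) F' = F :=
    exists_map_eq_of_coeffs_subset A fun z hz => hZA z (by simp [Z, Finset.mem_coe.mp hz])
  obtain ⟨b, hb⟩ : ∃ b : A, (b : K) = (coeff μF F)⁻¹ := ⟨⟨_, hZA _ (by simp [Z])⟩, rfl⟩
  have hw' : ∀ i, ∃ f', map (algebraMap A K) f' = w i := fun i =>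
    exists_map_eq_of_coeffs_subset A fun z hz => hZA z (by
      simp only [Z, Finset.mem_union, Finset.mem_biUnion]
      exact Or.inl <| Or.inl <| Or.inl <| Or.inr ⟨i, Finset.mem_univ _, hz⟩)
  choose w' hw' using hw'
  have hg' : ∀ i j, ∃ f', map (algebraMap A K) f' = g i j := fun i j =>
    exists_map_eq_of_coeffs_subset A fun z hz => hZA z (by
      simp only [Z, Finset.mem_union, Finset.mem_biUnion]
      exact Or.inl <| Or.inl <| Or.inr ⟨i, Finset.mem_univ _, j, Finset.mem_univ _, hz⟩)
  choose g' hg' using hg'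
  have hθ' : ∀ μ i ν, ∃ t : A, μ ∈ T (a - 1) → ν ∈ T (e i * (s + h) + (a - 1)) →
      (t : K) = θ μ i ν := by
    intro μ i ν
    by_cases hμ : μ ∈ T (a - 1)
    · by_cases hν : ν ∈ T (e i * (s + h) + (a - 1))
      · refine ⟨⟨θ μ i ν, hZA _ ?_⟩, fun _ _ => rfl⟩
        simp only [Z, Finset.mem_union, Finset.mem_biUnion]
        exact Or.inr ⟨μ, hμ, i, Finset.mem_univ _, Finset.mem_image_of_mem _ hν⟩
      · exact ⟨0, fun _ h => absurd h hν⟩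
    · exact ⟨0, fun h => absurd h hμ⟩
  choose θ' hθ' using hθ'
  have hmem' : ∀ i, w' i * F' ∈ Ideal.span (Set.range (g' i)) ^ n := fun i =>
    hZP i A (fun z hz => hZA z (by
      simp only [Z, Finset.mem_union, Finset.mem_biUnion]
      exact Or.inl <| Or.inr ⟨i, Finset.mem_univ _, hz⟩)) _ _ (hg' i) (by rw [map_mul, hw', hF'])
  obtain ⟨L, _, p, _, _, _, ⟨ψ⟩⟩ := exists_perfect_charP_ringHom A
  have hFL0 : map ψ F' ≠ 0 := by
    refine ne_zero_iff.mpr ⟨μF, fun h0 => ?_⟩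
    have h1 : coeff μF F' * b = 1 := Subtype.val_injective (by
      change algebraMap A K (coeff μF F') * (b : K) = 1
      rw [← coeff_map, hF', hb, mul_inv_cancel₀ hμF])
    have h2 := congrArg ψ h1
    rw [map_mul, ← coeff_map, h0, zero_mul, map_one] at h2
    exact zero_ne_one h2
  have hFh : (map ψ F').IsHomogeneous d :=
    (IsHomogeneous.of_map (f := algebraMap A K) Subtype.val_injective (by rwa [hF'])).map ψ
  obtain ⟨G, hG0, hG, hGm⟩ :=
    exists_isHomogeneous_pow_mul_mem_span_pow_of_charP p hh hn hlt hFL0 hFh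
    (fun i => map ψ (w' i)) (fun i j => map ψ (g' i j))
    (fun i => by
      rw [← map_mul]
      exact map_mem_span_range_pow ψ (hmem' i))
  refine hG0 (MvPolynomial.ext _ _ fun μ => ?_)
  rw [coeff_zero]
  by_contra hμ
  have hμT : μ ∈ T (a - 1) :=
    (hT _ _).mpr (hG.degree_eq_sum_deg_support (mem_support_iff.mpr hμ)).symm
  have hsum : ∀ i (f : MvPolynomial σ A),
      ((∑ ν ∈ T (e i * (s + h) + (a - 1)), θ' μ i ν * coeff ν f : A) : K) =
        ∑ ν ∈ T (e i * (s + h) + (a - 1)), θ μ i ν * coeff ν (map (algebraMap A K) f) := by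
    intro i f
    rw [AddSubmonoidClass.coe_finsetSum]
    refine Finset.sum_congr rfl fun ν hν => ?_
    rw [coeff_map, ← hθ' μ i ν hμT hν]
    rfl
  refine hμ (coeff_eq_zero_of_functional ψ (fun i => Ideal.span (Set.range (g' i)) ^ s)
    (fun i => w' i ^ (s + h)) (a - 1) (fun i => T (e i * (s + h) + (a - 1))) (θ' μ) μ ?_ ?_ hG ?_)
  · intro i f hf
    refine Subtype.val_injective ?_
    rw [hsum]
    refine hθJ μ i _ ?_
    have := map_mem_span_range_pow (algebraMap A K) hf
    rwa [funext (hg' i)] at this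
  · intro γ hγ
    refine Subtype.val_injective ?_
    rw [AddSubmonoidClass.coe_finsetSum]
    simp only [hsum]
    have := hθ μ (monomial γ 1) (isHomogeneous_monomial _ hγ)
    simp only [map_mul, map_pow, hw', map_monomial, map_one]
    rw [this, coeff_monomial, coeff_monomial]
    split_ifs <;> rfl
  · intro i
    rw [map_pow, Ideal.map_pow, Ideal.map_span, ← Set.range_comp]
    exact hGm i

open IsLocalRing in
theorem IsRegularLocalRing.exists_fin_span_range_eq_maximalIdeal {A : Type*} [CommRing A]
    [IsRegularLocalRing A] {h : ℕ} (hdim : ringKrullDim A ≤ h) {S : Set A} (h0 : 0 ∈ S)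
    (hS : Ideal.span S = maximalIdeal A) :
    ∃ g : Fin h → A, (∀ j, g j ∈ S) ∧ Ideal.span (Set.range g) = maximalIdeal A := by
  let S' : Set (maximalIdeal A) := Subtype.val ⁻¹' S
  have hS' : Submodule.span A S' = ⊤ := by
    refine Submodule.map_injective_of_injective (maximalIdeal A).subtype_injective ?_
    rw [Submodule.map_span, Submodule.map_top, Submodule.range_subtype]
    refine Eq.trans ?_ hS
    have himage : (maximalIdeal A).subtype '' S' = S := by
      refine (Subtype.image_preimage_coe _ _).trans (Set.inter_eq_right.mpr ?_)
      exact fun x hx => hS ▸ Ideal.subset_span hx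
    rw [himage, Ideal.span]
  have hspan := CotangentSpace.span_image_eq_top_iff.mpr hS'
  have hr : Module.finrank (ResidueField A) (Submodule.span (ResidueField A)
      ((maximalIdeal A).toCotangent '' S')) ≤ h := by
    rw [hspan, finrank_top]
    have := (IsRegularLocalRing.iff_finrank_cotangentSpace A).mp inferInstance
    rw [← this] at hdim
    exact_mod_cast hdim
  obtain ⟨r, hr, f, hfS, hf⟩ : ∃ r ≤ h, ∃ f : Fin r → CotangentSpace A,
      (∀ i, f i ∈ (maximalIdeal A).toCotangent '' S') ∧
        Submodule.span (ResidueField A) (Set.range f) = ⊤ := by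
    obtain ⟨f, hfS, hf, -⟩ := Submodule.exists_fun_fin_finrank_span_eq (ResidueField A)
      ((maximalIdeal A).toCotangent '' S')
    exact ⟨_, hr, f, hfS, hf.trans hspan⟩
  choose y hyS hy using hfS
  have hyspan : Submodule.span A (Set.range y) = ⊤ := by
    rw [← CotangentSpace.span_image_eq_top_iff, ← Set.range_comp, ← hf]
    congr 2
    exact funext hy
  have hyspan' : Ideal.span (Set.range fun i => (y i : A)) = maximalIdeal A := by
    have := congrArg (Submodule.map (maximalIdeal A).subtype) hyspan
    rw [Submodule.map_span, Submodule.map_top, Submodule.range_subtype, ← Set.range_comp] at this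
    exact this
  refine ⟨fun j => if hj : j.1 < r then y ⟨j, hj⟩ else 0, fun j => ?_, le_antisymm ?_ ?_⟩
  · dsimp only
    split_ifs
    · exact hyS _
    · exact h0
  · rw [Ideal.span_le]
    rintro _ ⟨j, rfl⟩
    dsimp only
    split_ifs
    · exact (y _).2
    · exact zero_mem _
  · refine hyspan'.ge.trans (Ideal.span_le.mpr ?_)
    rintro _ ⟨i, rfl⟩
    refine Ideal.subset_span ⟨⟨i, i.2.trans_le hr⟩, ?_⟩
    simp

theorem exists_fin_generators_of_isRegularRing {R : Type*} [CommRing R] [IsRegularRing R]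
    {I P : Ideal R} [P.IsPrime] (hIP : I ≤ P) {u : R} (hu : u ∉ P) (huP : ∀ x ∈ P, u * x ∈ I)
    {h : ℕ} (hh : P.height ≤ h) {S : Set R} (h0 : 0 ∈ S) (hS : Ideal.span S = I) :
    ∃ g : Fin h → R, (∀ j, g j ∈ S) ∧ ∃ w ∉ P, ∀ f ∈ I, w * f ∈ Ideal.span (Set.range g) := by
  classical
  let A := Localization.AtPrime P
  have hmap : I.map (algebraMap R A) = IsLocalRing.maximalIdeal A := by
    rw [← Localization.AtPrime.map_eq_maximalIdeal]
    refine le_antisymm (Ideal.map_mono hIP) (Ideal.map_le_iff_le_comap.mpr fun x hx => ?_)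
    rw [Ideal.mem_comap]
    have h1 : IsUnit (algebraMap R A u) := IsLocalization.map_units A (⟨u, hu⟩ : P.primeCompl)
    rw [← Ideal.unit_mul_mem_iff_mem _ h1, ← map_mul]
    exact Ideal.mem_map_of_mem _ (huP x hx)
  have hdim : ringKrullDim A ≤ h := by
    rw [IsLocalization.AtPrime.ringKrullDim_eq_height P A]
    exact_mod_cast hh
  obtain ⟨gA, hgA, hgspan⟩ := IsRegularLocalRing.exists_fin_span_range_eq_maximalIdeal (A := A) hdim
    (S := algebraMap R A '' S) ⟨0, h0, map_zero _⟩ (by rw [← hmap, ← hS, Ideal.map_span])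
  choose g hgS hg using hgA
  refine ⟨g, hgS, ?_⟩
  have hgI : (Ideal.span (Set.range g)).map (algebraMap R A) = I.map (algebraMap R A) := by
    rw [hmap, ← hgspan, Ideal.map_span, ← Set.range_comp]
    congr 2
    exact funext hg
  have hloc : ∀ f ∈ I, ∃ w ∉ P, w * f ∈ Ideal.span (Set.range g) := by
    intro f hf
    have := hgI ▸ Ideal.mem_map_of_mem (algebraMap R A) hf
    obtain ⟨w, hw, h⟩ :=
      (IsLocalization.algebraMap_mem_map_algebraMap_iff P.primeCompl A _ _).mp this
    exact ⟨w, hw, h⟩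
  obtain ⟨T, hT⟩ := IsNoetherian.noetherian I
  choose! w hw hwf using hloc
  have hTI : ∀ t ∈ T, t ∈ I := fun t ht => hT ▸ Ideal.subset_span ht
  refine ⟨∏ t ∈ T, w t, ?_, fun f hf => ?_⟩
  · intro hmem
    obtain ⟨t, ht, h⟩ := (Ideal.IsPrime.prod_mem_iff (p := P)).mp hmem
    exact hw t (hTI t ht) h
  · rw [← hT] at hf
    induction hf using Submodule.span_induction with
    | mem x hx =>
      rw [← Finset.mul_prod_erase T w hx, mul_right_comm]
      exact Ideal.mul_mem_right _ _ (hwf x (hTI x hx))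
    | zero => simp
    | add x y _ _ hx hy =>
      rw [mul_add]
      exact Ideal.add_mem _ hx hy
    | smul t x _ hx =>
      rw [smul_eq_mul, mul_left_comm]
      exact Ideal.mul_mem_left _ _ hx

theorem exists_notMem_mul_mem_of_mem_associatedPrimes {R : Type*} [CommRing R] [IsNoetherianRing R]
    {I P : Ideal R} (hI : I.IsRadical) (hP : P ∈ associatedPrimes R (R ⧸ I)) :
    I ≤ P ∧ ∃ u ∉ P, ∀ x ∈ P, u * x ∈ I := by
  obtain ⟨hprime, x, hx⟩ := isAssociatedPrime_iff.mp hP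
  obtain ⟨u, rfl⟩ := Ideal.Quotient.mk_surjective x
  have hmem : ∀ y, y ∈ P ↔ u * y ∈ I := by
    intro y
    rw [hx, Submodule.mem_colon_singleton, Submodule.mem_bot, Algebra.smul_def,
      Ideal.Quotient.algebraMap_eq, ← map_mul, Ideal.Quotient.eq_zero_iff_mem, mul_comm]
  refine ⟨fun y hy => (hmem y).mpr (I.mul_mem_left _ hy), u, fun hu => ?_, fun y => (hmem y).mp⟩
  have huI : u ∈ I := hI ⟨2, by rw [pow_two]; exact (hmem u).mp hu⟩
  exact hprime.ne_top ((Ideal.eq_top_iff_one P).mpr ((hmem 1).mpr (by simpa using huI)))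

section HomogeneousIdeal

variable {K σ : Type*}

theorem span_isHomogeneous_eq_self [CommRing K] {I : Ideal (MvPolynomial σ K)}
    (hI : ∀ f ∈ I, ∀ d, homogeneousComponent d f ∈ I) :
    Ideal.span {f | f ∈ I ∧ ∃ d, f.IsHomogeneous d} = I := by
  refine le_antisymm (Ideal.span_le.mpr fun f hf => hf.1) fun f hf => ?_
  rw [← sum_homogeneousComponent f]
  exact Ideal.sum_mem _ fun i _ => Ideal.subset_span
    ⟨hI f hf i, i, homogeneousComponent_isHomogeneous i f⟩

theorem homogeneousComponent_mem_pow [CommRing K] {I : Ideal (MvPolynomial σ K)}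
    (hI : ∀ f ∈ I, ∀ d, homogeneousComponent d f ∈ I) {n : ℕ} {f : MvPolynomial σ K}
    (hf : f ∈ I ^ n) (d : ℕ) : homogeneousComponent d f ∈ I ^ n := by
  let g : {f | f ∈ I ∧ ∃ d, f.IsHomogeneous d} → MvPolynomial σ K := Subtype.val
  have hg : Ideal.span (Set.range g) = I := by
    rw [Subtype.range_val, span_isHomogeneous_eq_self hI]
  rw [← hg] at hf ⊢
  choose δ hδ using fun j : {f | f ∈ I ∧ ∃ d, f.IsHomogeneous d} => j.2.2
  exact homogeneousComponent_mem_span_range_pow hδ n hf d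

theorem homogeneousComponent_mem_of_mul_mem [CommRing K] {I P : Ideal (MvPolynomial σ K)}
    [P.IsPrime] (hI : ∀ f ∈ I, ∀ d, homogeneousComponent d f ∈ I) (hIP : I ≤ P)
    {u : MvPolynomial σ K} (hu : u ∉ P) (huP : ∀ x ∈ P, u * x ∈ I) {f : MvPolynomial σ K}
    (hf : f ∈ P) (d : ℕ) : homogeneousComponent d f ∈ P := by
  let _ : GradedAlgebra (homogeneousSubmodule σ K) := MvPolynomial.gradedAlgebra
  have hIhom : I.IsHomogeneous (homogeneousSubmodule σ K) := by
    rw [← span_isHomogeneous_eq_self hI]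
    exact Ideal.homogeneous_span _ _ fun f hf => hf.2
  let Q := P.homogeneousCore (homogeneousSubmodule σ K)
  have hQP : Q.toIdeal ≤ P := Ideal.toIdeal_homogeneousCore_le _ P
  have hQ : Q.toIdeal.IsPrime := Ideal.IsPrime.homogeneousCore ‹_›
  have hIQ : I ≤ Q.toIdeal :=
    hIhom.toIdeal_homogeneousCore_eq_self.symm.trans_le (Ideal.homogeneousCore_mono _ hIP)
  have hPQ : f ∈ Q.toIdeal :=
    (hQ.mem_or_mem (hIQ (huP f hf))).resolve_left fun h => hu (hQP h)
  exact hQP (homogeneousComponent_mem_of_mem Q.isHomogeneous hPQ d)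

theorem exists_homogeneousComponent_notMem [CommSemiring K] {P : Ideal (MvPolynomial σ K)}
    {f : MvPolynomial σ K} (hf : f ∉ P) : ∃ d, homogeneousComponent d f ∉ P := by
  by_contra! h
  exact hf (sum_homogeneousComponent f ▸ Ideal.sum_mem _ fun i _ => h i)

theorem homogeneousComponent_add_mul_of_isHomogeneous [CommSemiring K] {d : ℕ}
    {F : MvPolynomial σ K} (hF : F.IsHomogeneous d) (f : MvPolynomial σ K) (e : ℕ) :
    homogeneousComponent (e + d) (f * F) = homogeneousComponent e f * F := by
  have h1 : ∀ i, homogeneousComponent (e + d) (homogeneousComponent i f * F) =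
      homogeneousComponent e (homogeneousComponent i f) * F := by
    intro i
    have h2 := homogeneousComponent_isHomogeneous i f
    rw [homogeneousComponent_of_mem (n := i) h2, homogeneousComponent_of_mem (h2.mul hF)]
    simp only [add_left_inj, ite_mul, zero_mul]
  calc homogeneousComponent (e + d) (f * F)
      = homogeneousComponent (e + d)
          ((∑ i ∈ Finset.range (f.totalDegree + 1), homogeneousComponent i f) * F) := by
        rw [sum_homogeneousComponent]
    _ = homogeneousComponent e
          (∑ i ∈ Finset.range (f.totalDegree + 1), homogeneousComponent i f) * F := by
        rw [Finset.sum_mul, map_sum, map_sum, Finset.sum_mul]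
        exact Finset.sum_congr rfl fun i _ => h1 i
    _ = homogeneousComponent e f * F := by rw [sum_homogeneousComponent]

theorem homogeneousComponent_mem_pow_idealOfVars [CommSemiring K] (d : ℕ) (f : MvPolynomial σ K) :
    homogeneousComponent d f ∈ idealOfVars σ K ^ d := by
  rw [mem_pow_idealOfVars_iff']
  intro x hx
  rw [coeff_homogeneousComponent, if_neg hx.ne]

theorem homogeneousComponent_eq_zero_of_mem_pow_idealOfVars [CommSemiring K] {d : ℕ}
    {f : MvPolynomial σ K} (hf : f ∈ idealOfVars σ K ^ (d + 1)) :
    homogeneousComponent d f = 0 := by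
  ext x
  rw [coeff_homogeneousComponent, coeff_zero]
  split_ifs with h
  · exact (mem_pow_idealOfVars_iff' _ _).mp hf x (by omega)
  · rfl

theorem le_of_mem_pow_idealOfVars_of_isHomogeneous [CommSemiring K] {a d : ℕ} {f : MvPolynomial σ K}
    (hf : f.IsHomogeneous a) (hf0 : f ≠ 0) (hmem : f ∈ idealOfVars σ K ^ d) : d ≤ a := by
  by_contra! h
  refine hf0 ?_
  rw [← homogeneousComponent_eq_self hf]
  exact homogeneousComponent_eq_zero_of_mem_pow_idealOfVars (Ideal.pow_le_pow_right h hmem)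

theorem sub_homogeneousComponent_mem_pow_idealOfVars [CommRing K] {d : ℕ}
    {f : MvPolynomial σ K} (hf : f ∈ idealOfVars σ K ^ d) :
    f - homogeneousComponent d f ∈ idealOfVars σ K ^ (d + 1) := by
  rw [mem_pow_idealOfVars_iff'] at hf ⊢
  intro x hx
  rw [coeff_sub, coeff_homogeneousComponent]
  split_ifs with h
  · exact sub_self _
  · rw [hf x (by omega), sub_zero]

theorem homogeneousComponent_mul_of_mem_pow_idealOfVars [CommRing K] {i j : ℕ}
    {f g : MvPolynomial σ K} (hf : f ∈ idealOfVars σ K ^ i) (hg : g ∈ idealOfVars σ K ^ j) :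
    homogeneousComponent (i + j) (f * g) = homogeneousComponent i f * homogeneousComponent j g := by
  have h1 : f * g - homogeneousComponent i f * homogeneousComponent j g ∈
      idealOfVars σ K ^ (i + j + 1) := by
    have h2 : f * g - homogeneousComponent i f * homogeneousComponent j g =
        (f - homogeneousComponent i f) * g +
          homogeneousComponent i f * (g - homogeneousComponent j g) := by ring
    rw [h2]
    refine Ideal.add_mem _ ?_ ?_
    · rw [add_right_comm, pow_add _ (i + 1)]
      exact Ideal.mul_mem_mul (sub_homogeneousComponent_mem_pow_idealOfVars hf) hg
    · rw [add_assoc, pow_add]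
      exact Ideal.mul_mem_mul (homogeneousComponent_mem_pow_idealOfVars i f)
        (sub_homogeneousComponent_mem_pow_idealOfVars hg)
  have h3 := homogeneousComponent_eq_zero_of_mem_pow_idealOfVars h1
  rw [map_sub, homogeneousComponent_eq_self ((homogeneousComponent_isHomogeneous i f).mul
    (homogeneousComponent_isHomogeneous j g))] at h3
  exact sub_eq_zero.mp h3

theorem homogeneousComponent_pow_of_mem_pow_idealOfVars [CommRing K] {i : ℕ}
    {f : MvPolynomial σ K} (hf : f ∈ idealOfVars σ K ^ i) (n : ℕ) :
    homogeneousComponent (i * n) (f ^ n) = homogeneousComponent i f ^ n := by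
  induction n with
  | zero => simp [homogeneousComponent_zero]
  | succ n ih =>
    rw [Nat.mul_succ, pow_succ, homogeneousComponent_mul_of_mem_pow_idealOfVars _ hf, ih, pow_succ]
    rw [pow_mul]
    exact Ideal.pow_mem_pow hf n

theorem exists_mul_homogeneousComponent_mem_pow [CommRing K] {I P : Ideal (MvPolynomial σ K)}
    [P.IsPrime] (hI : ∀ f ∈ I, ∀ d, homogeneousComponent d f ∈ I) (hIP : I ≤ P)
    {u : MvPolynomial σ K} (hu : u ∉ P) (huP : ∀ x ∈ P, u * x ∈ I) {i m : ℕ}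
    {s f : MvPolynomial σ K} (hf : f ∈ idealOfVars σ K ^ i) (hs : s ∉ P) (hsf : s * f ∈ I ^ m) :
    ∃ t ∉ P, t * homogeneousComponent i f ∈ I ^ m := by
  classical
  obtain ⟨l, hl⟩ := exists_homogeneousComponent_notMem hu
  set v := homogeneousComponent l u with hv
  have hvl : v.IsHomogeneous l := homogeneousComponent_isHomogeneous l u
  have hvP : ∀ x ∈ P, v * x ∈ I := by
    intro x hx
    rw [← sum_homogeneousComponent x, Finset.mul_sum]
    refine Ideal.sum_mem _ fun j _ => ?_
    have h1 := hI _ (huP _ (homogeneousComponent_mem_of_mul_mem hI hIP hu huP hx j)) (l + j)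
    rwa [homogeneousComponent_add_mul_of_isHomogeneous (homogeneousComponent_isHomogeneous j x)]
      at h1
  have hex := exists_homogeneousComponent_notMem hs
  set e := Nat.find hex with he
  have hse : homogeneousComponent e s ∉ P := Nat.find_spec hex
  set p := ∑ j ∈ Finset.range e, homogeneousComponent j s with hp
  have hpP : p ∈ P := Ideal.sum_mem _ fun j hj =>
    not_not.mp (Nat.find_min hex (Finset.mem_range.mp hj))
  have hcoeff : ∀ x, coeff x p = if x.degree < e then coeff x s else 0 := by
    intro x
    simp [hp, coeff_sum, coeff_homogeneousComponent]
  have hsp : s - p ∈ idealOfVars σ K ^ e := by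
    rw [mem_pow_idealOfVars_iff']
    intro x hx
    rw [coeff_sub, hcoeff, if_pos hx, sub_self]
  have hspe : homogeneousComponent e (s - p) = homogeneousComponent e s := by
    ext x
    rw [coeff_homogeneousComponent, coeff_homogeneousComponent, coeff_sub, hcoeff]
    split_ifs with h1 h2
    · omega
    · rw [sub_zero]
    · rfl
  have hmem : (v * (s - p)) ^ m * f ∈ I ^ m := by
    obtain ⟨y, hy⟩ : s ∣ (s - p) ^ m - (-p) ^ m := by
      simpa using sub_dvd_pow_sub_pow (s - p) (-p) m
    have h1 : (v * (s - p)) ^ m * f = v ^ m * y * (s * f) + (-1) ^ m * f * (v * p) ^ m := by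
      rw [mul_pow, sub_eq_iff_eq_add.mp hy, neg_pow p]
      ring
    rw [h1]
    exact Ideal.add_mem _ (Ideal.mul_mem_left _ _ hsf)
      (Ideal.mul_mem_left _ _ (Ideal.pow_mem_pow (hvP p hpP) m))
  have hvm : v ∈ idealOfVars σ K ^ l := homogeneousComponent_mem_pow_idealOfVars l u
  have hvsp : v * (s - p) ∈ idealOfVars σ K ^ (l + e) := by
    rw [pow_add]
    exact Ideal.mul_mem_mul hvm hsp
  refine ⟨(v * homogeneousComponent e s) ^ m, fun h => ?_, ?_⟩
  · exact (Ideal.IsPrime.mem_or_mem ‹_› (Ideal.IsPrime.mem_of_pow_mem ‹_› m h)).elim hl hse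
  · have := homogeneousComponent_mem_pow hI hmem ((l + e) * m + i)
    rwa [homogeneousComponent_mul_of_mem_pow_idealOfVars (by
      rw [pow_mul]
      exact Ideal.pow_mem_pow hvsp m) hf, homogeneousComponent_pow_of_mem_pow_idealOfVars hvsp,
      homogeneousComponent_mul_of_mem_pow_idealOfVars hvm hsp, hspe,
      homogeneousComponent_eq_self hvl] at this

end HomogeneousIdeal

section SymbolicPower

variable {K σ : Type*} [Field K]

theorem Ideal.pow_le_symbolicPower {R : Type*} [CommRing R] (I : Ideal R) (n : ℕ) :
    I ^ n ≤ symbolicPower I n := fun f hf P hP =>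
  ⟨1, fun h => hP.1.ne_top ((Ideal.eq_top_iff_one P).mpr h), by rwa [one_mul]⟩

theorem homogeneousComponent_mem_symbolicPower [Finite σ] {I : Ideal (MvPolynomial σ K)}
    (hI : ∀ f ∈ I, ∀ d, homogeneousComponent d f ∈ I) (hrad : I.IsRadical) {i m : ℕ}
    {f : MvPolynomial σ K} (hf : f ∈ symbolicPower I m) (hfi : f ∈ idealOfVars σ K ^ i) :
    homogeneousComponent i f ∈ symbolicPower I m := by
  intro P hP
  have := hP.1
  obtain ⟨hIP, u, hu, huP⟩ := exists_notMem_mul_mem_of_mem_associatedPrimes hrad hP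
  obtain ⟨s, hs, hsf⟩ := hf P hP
  exact exists_mul_homogeneousComponent_mem_pow hI hIP hu huP hfi hs hsf

theorem symbolicPower_le_pow_idealOfVars [Finite σ] {I : Ideal (MvPolynomial σ K)}
    (hI : ∀ f ∈ I, ∀ d, homogeneousComponent d f ∈ I) (hrad : I.IsRadical) (m : ℕ) :
    symbolicPower I m ≤ idealOfVars σ K ^ alphaDeg (symbolicPower I m) := by
  intro f hf
  suffices h : ∀ i ≤ alphaDeg (symbolicPower I m), f ∈ idealOfVars σ K ^ i from h _ le_rfl
  intro i
  induction i with
  | zero => simp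
  | succ i ih =>
    intro hi
    have hfi := ih (by omega)
    have h0 : homogeneousComponent i f = 0 := by
      by_contra h0
      exact Nat.notMem_of_lt_sInf hi ⟨_, homogeneousComponent_mem_symbolicPower hI hrad hf hfi, h0,
        homogeneousComponent_isHomogeneous i f⟩
    simpa [h0] using sub_homogeneousComponent_mem_pow_idealOfVars hfi

theorem exists_mem_alphaDeg_symbolicPower {I : Ideal (MvPolynomial σ K)}
    (hI : ∀ f ∈ I, ∀ d, homogeneousComponent d f ∈ I) (hI0 : I ≠ ⊥) (n : ℕ) :
    ∃ f ∈ symbolicPower I n, f ≠ 0 ∧ f.IsHomogeneous (alphaDeg (symbolicPower I n)) := by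
  refine Nat.sInf_mem (s := {d | ∃ f ∈ symbolicPower I n, f ≠ 0 ∧ f.IsHomogeneous d}) ?_
  obtain ⟨f, hf, hf0⟩ := Submodule.exists_mem_ne_zero_of_ne_bot hI0
  obtain ⟨d, hd⟩ := exists_homogeneousComponent_notMem (P := ⊥) hf0
  exact ⟨d * n, homogeneousComponent d f ^ n,
    I.pow_le_symbolicPower n (Ideal.pow_mem_pow (hI f hf d) n), pow_ne_zero _ hd,
    (homogeneousComponent_isHomogeneous d f).pow n⟩

theorem exists_homogeneous_generators_of_mem_associatedPrimes [Finite σ]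
    {I P : Ideal (MvPolynomial σ K)} (hI : ∀ f ∈ I, ∀ d, homogeneousComponent d f ∈ I)
    (hrad : I.IsRadical) (hP : P ∈ associatedPrimes (MvPolynomial σ K) (MvPolynomial σ K ⧸ I))
    {h : ℕ} (hh : P.height ≤ h) {n d : ℕ} {F : MvPolynomial σ K} (hF : F ∈ symbolicPower I n)
    (hFd : F.IsHomogeneous d) :
    ∃ g : Fin h → MvPolynomial σ K, (∀ j, g j ∈ I) ∧ (∃ δ : Fin h → ℕ,
      ∀ j, (g j).IsHomogeneous (δ j)) ∧ ∃ w ∉ P, (∃ e, w.IsHomogeneous e) ∧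
        w * F ∈ Ideal.span (Set.range g) ^ n := by
  have := hP.1
  obtain ⟨hIP, u, hu, huP⟩ := exists_notMem_mul_mem_of_mem_associatedPrimes hrad hP
  obtain ⟨g, hg, w, hw, hwI⟩ := exists_fin_generators_of_isRegularRing hIP hu huP hh
    (S := {f | f ∈ I ∧ ∃ d, f.IsHomogeneous d}) ⟨zero_mem _, 0, isHomogeneous_zero _ _ _⟩
    (span_isHomogeneous_eq_self hI)
  choose hgI δ hδ using hg
  obtain ⟨v, hv, hvF⟩ := hF P hP
  have hwv : w ^ n * v ∉ P := fun hmem =>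
    (Ideal.IsPrime.mem_or_mem ‹_› hmem).elim (fun h => hw (Ideal.IsPrime.mem_of_pow_mem ‹_› n h)) hv
  obtain ⟨e, he⟩ := exists_homogeneousComponent_notMem hwv
  refine ⟨g, hgI, ⟨δ, hδ⟩, _, he, ⟨e, homogeneousComponent_isHomogeneous e _⟩, ?_⟩
  have hmem : w ^ n * v * F ∈ Ideal.span (Set.range g) ^ n := by
    have h1 : Ideal.span {w} * I ≤ Ideal.span (Set.range g) := by
      rw [Ideal.span_singleton_mul_le_iff]
      exact hwI
    have h2 := Ideal.pow_right_mono h1 n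
    rw [mul_pow, Ideal.span_singleton_pow] at h2
    rw [mul_assoc]
    exact h2 (Ideal.mul_mem_mul (Ideal.mem_span_singleton_self _) hvF)
  rw [← homogeneousComponent_add_mul_of_isHomogeneous hFd]
  exact homogeneousComponent_mem_span_range_pow hδ n hmem (e + d)

theorem mul_alphaDeg_symbolicPower_le [Finite σ] [Nonempty σ] {I : Ideal (MvPolynomial σ K)}
    (hI : ∀ f ∈ I, ∀ d, homogeneousComponent d f ∈ I) (hrad : I.IsRadical) (hI0 : I ≠ ⊥) {h : ℕ}
    (hh : 0 < h)
    (hht : ∀ P ∈ associatedPrimes (MvPolynomial σ K) (MvPolynomial σ K ⧸ I), P.height ≤ h)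
    {n s : ℕ} (hn : 0 < n) :
    n * alphaDeg (symbolicPower I s) ≤ alphaDeg (symbolicPower I n) * (s + h - 1) := by
  by_contra! hlt
  obtain ⟨F, hF, hF0, hFd⟩ := exists_mem_alphaDeg_symbolicPower hI hI0 n
  have : Finite (associatedPrimes (MvPolynomial σ K) (MvPolynomial σ K ⧸ I)) :=
    associatedPrimes.finite _ _
  choose g hgI hgδ w hwP hwe hwF using
    fun P : associatedPrimes (MvPolynomial σ K) (MvPolynomial σ K ⧸ I) =>
    exists_homogeneous_generators_of_mem_associatedPrimes hI hrad P.2 (hht P P.2) hF hFd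
  choose δ hδ using hgδ
  choose e he using hwe
  obtain ⟨G, hG0, hG, hGm⟩ :=
    exists_isHomogeneous_pow_mul_mem_span_pow hh hn hlt hF0 hFd w e he g δ hδ hwF
  have hpos : 0 < alphaDeg (symbolicPower I s) :=
    Nat.pos_of_ne_zero fun h0 => by simp [h0] at hlt
  refine Nat.notMem_of_lt_sInf (Nat.sub_lt hpos one_pos) ⟨G, fun P hP => ?_, hG0, hG⟩
  refine ⟨w ⟨P, hP⟩ ^ (s + h), fun hmem => hwP ⟨P, hP⟩ (hP.1.mem_of_pow_mem _ hmem), ?_⟩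
  refine Ideal.pow_right_mono (Ideal.span_le.mpr ?_) s (hGm ⟨P, hP⟩)
  rintro _ ⟨j, rfl⟩
  exact hgI _ j

theorem alphaDeg_symbolicPower_bot {n : ℕ} (hn : n ≠ 0)
    (h : (associatedPrimes (MvPolynomial σ K)
      (MvPolynomial σ K ⧸ (⊥ : Ideal (MvPolynomial σ K)))).Nonempty) :
    alphaDeg (symbolicPower (⊥ : Ideal (MvPolynomial σ K)) n) = 0 := by
  obtain ⟨P, hP⟩ := h
  refine Nat.sInf_eq_zero.mpr (.inr (Set.eq_empty_iff_forall_notMem.mpr ?_))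
  rintro d ⟨f, hf, hf0, -⟩
  obtain ⟨s, hs, hsf⟩ := hf P hP
  rw [Ideal.bot_pow hn, Ideal.mem_bot, mul_eq_zero] at hsf
  exact hs (hsf.resolve_right hf0 ▸ P.zero_mem)

end SymbolicPower

/-- **Lemma 2.3 / Lemma `lem.14all`.** Let `R = k[x_0,…,x_N]` with maximal homogeneous ideal
`𝔪`, and let `I` be a homogeneous radical ideal of big height `h`.  If for some `c ≥ 1`
one has `I^{(c(h+m−1)−h+1)} ⊆ 𝔪^{c(h−1)} (I^{(m)})^c`, then for all `n ≥ 1`,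
`(m+h−1)·α(I^{(n)}) ≥ n·(α(I^{(m)}) + h − 1)`, i.e. `α̂(I) ≥ (α(I^{(m)})+h−1)/(m+h−1)`. -/
theorem stmt_0 {k : Type*} [Field k] (N h m : ℕ) (hm : 1 ≤ m)
    (I : Ideal (MvPolynomial (Fin (N + 1)) k))
    (hhom : ∀ f ∈ I, ∀ d, MvPolynomial.homogeneousComponent d f ∈ I)
    (hrad : I.IsRadical)
    (hht_le : ∀ P, ∀ hP : P ∈ associatedPrimes (MvPolynomial (Fin (N + 1)) k)
        (MvPolynomial (Fin (N + 1)) k ⧸ I),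
      Order.height (⟨P, hP.1⟩ : PrimeSpectrum (MvPolynomial (Fin (N + 1)) k)) ≤ (h : ℕ∞))
    (hht_eq : ∃ P, ∃ hP : P ∈ associatedPrimes (MvPolynomial (Fin (N + 1)) k)
        (MvPolynomial (Fin (N + 1)) k ⧸ I),
      Order.height (⟨P, hP.1⟩ : PrimeSpectrum (MvPolynomial (Fin (N + 1)) k)) = (h : ℕ∞))
    (hcont : ∃ c : ℕ, 1 ≤ c ∧
      symbolicPower I (c * (h + m - 1) - h + 1) ≤
        (Ideal.span (Set.range (MvPolynomial.X : Fin (N + 1) → MvPolynomial (Fin (N + 1)) k)))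
            ^ (c * (h - 1)) * (symbolicPower I m) ^ c) :
    ∀ n : ℕ, 1 ≤ n →
      n * (alphaDeg (symbolicPower I m) + h - 1) ≤
        (m + h - 1) * alphaDeg (symbolicPower I n) := by
  intro n hn
  have hheight : ∀ P, ∀ hP : P ∈ associatedPrimes (MvPolynomial (Fin (N + 1)) k)
      (MvPolynomial (Fin (N + 1)) k ⧸ I), P.height =
        Order.height (⟨P, hP.1⟩ : PrimeSpectrum (MvPolynomial (Fin (N + 1)) k)) :=
    fun P hP => PrimeSpectrum.height_eq_orderHeight ⟨P, hP.1⟩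
  obtain ⟨P, hP, hPh⟩ := hht_eq
  have := hP.1
  obtain ⟨hIP, u, hu, huP⟩ := exists_notMem_mul_mem_of_mem_associatedPrimes hrad hP
  rw [← hheight P hP] at hPh
  rcases Nat.eq_zero_or_pos h with rfl | hh
  · have hP0 : P = ⊥ := by
      rwa [Nat.cast_zero, Ideal.height_eq_zero_iff,
        IsDomain.minimalPrimes_eq_singleton_bot, Set.mem_singleton_iff] at hPh
    obtain rfl : I = ⊥ := le_bot_iff.mp (hP0 ▸ hIP)
    rw [alphaDeg_symbolicPower_bot (by omega) ⟨P, hP⟩]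
    simp
  · have hI0 : I ≠ ⊥ := by
      rintro rfl
      have hP0 : P = ⊥ := le_bot_iff.mp fun x hx =>
        (mul_eq_zero.mp (huP x hx)).resolve_left fun h0 => hu (h0 ▸ P.zero_mem)
      rw [hP0, Ideal.height_bot] at hPh
      exact hh.ne (by exact_mod_cast hPh)
    obtain ⟨c, hc, hcont⟩ := hcont
    obtain ⟨G, hG, hG0, hGd⟩ :=
      exists_mem_alphaDeg_symbolicPower hhom hI0 (c * (h + m - 1) - h + 1)
    have hlower := le_of_mem_pow_idealOfVars_of_isHomogeneous hGd hG0
      (d := c * (h - 1) + alphaDeg (symbolicPower I m) * c) (by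
        rw [pow_add, pow_mul _ (alphaDeg _)]
        exact Ideal.mul_mono_right
          (Ideal.pow_right_mono (symbolicPower_le_pow_idealOfVars hhom hrad m) c) (hcont hG))
    have hupper := mul_alphaDeg_symbolicPower_le hhom hrad hI0 hh
      (fun P hP => (hheight P hP).trans_le (hht_le P hP)) (s := c * (h + m - 1) - h + 1) hn
    have hs : c * (h + m - 1) - h + 1 + h - 1 = c * (h + m - 1) := by
      have : h + m - 1 ≤ c * (h + m - 1) := Nat.le_mul_of_pos_left _ hc
      omega
    rw [hs] at hupper
    refine Nat.le_of_mul_le_mul_left ?_ hc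
    calc c * (n * (alphaDeg (symbolicPower I m) + h - 1))
        = n * (c * (h - 1) + alphaDeg (symbolicPower I m) * c) := by
          rw [Nat.add_sub_assoc hh]
          ring
      _ ≤ _ := Nat.mul_le_mul_left n hlower
      _ ≤ _ := hupper
      _ = c * ((m + h - 1) * alphaDeg (symbolicPower I n)) := by
          rw [add_comm m h]
          ring
end

section
/- For all integers N ≥ 3, m ≥ 1 and k ≥ 2m+2, the binomial coefficient inequality C((k−1)(m+N−1)+N−1, N) ≥ (k+1)^N · C(m+N−1, N) holds, where C(a,b) denotes the binomial coefficient a choose b. -/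
/-- If the midpoint of `[a, a + d]` is at least `c` times that of `[m, m + d]`, then products of
terms placed symmetrically about the midpoints compare with ratio `c ^ 2`. -/
theorem sq_mul_symmetric_pair_le {a c m i j : ℕ} (hc : 1 ≤ c)
    (h : c * (2 * m + (i + j)) ≤ 2 * a + (i + j)) :
    (c * (m + i)) * (c * (m + j)) ≤ (a + i) * (a + j) := by
  zify at *
  have h₁ : ((c : ℤ) * (2 * m + (i + j))) ^ 2 ≤ (2 * a + (i + j)) ^ 2 :=
    pow_le_pow_left₀ (by positivity) h 2
  have h₂ : 0 ≤ ((c : ℤ) ^ 2 - 1) * (i - j) ^ 2 :=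
    mul_nonneg (by nlinarith) (sq_nonneg _)
  linarith

theorem pow_mul_ascFactorial_le {a c m n : ℕ} (hc : 1 ≤ c)
    (h : c * (2 * m + (n - 1)) ≤ 2 * a + (n - 1)) :
    c ^ n * m.ascFactorial n ≤ a.ascFactorial n := by
  have prod_sq (f : ℕ → ℕ) :
      (∏ i ∈ Finset.range n, f i) ^ 2 = ∏ i ∈ Finset.range n, f i * f (n - 1 - i) := by
    rw [Finset.prod_mul_distrib, Finset.prod_range_reflect, sq]
  have hpow : c ^ n * m.ascFactorial n = ∏ i ∈ Finset.range n, c * (m + i) := by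
    simp [Nat.ascFactorial_eq_prod_range, Finset.prod_mul_distrib]
  rw [hpow, Nat.ascFactorial_eq_prod_range, ← Nat.pow_le_pow_iff_left two_ne_zero,
    prod_sq, prod_sq]
  refine Finset.prod_le_prod' fun i hi ↦ sq_mul_symmetric_pair_le hc ?_
  have hi' : i + (n - 1 - i) = n - 1 := by
    have := Finset.mem_range.mp hi
    omega
  rwa [hi']

/-- For all integers `N ≥ 3`, `m ≥ 1` and `k ≥ 2m+2`,
`C((k−1)(m+N−1)+N−1, N) ≥ (k+1)^N · C(m+N−1, N)`. -/
theorem stmt_1 (N m k : ℕ) (hN : 3 ≤ N) (hm : 1 ≤ m) (hk : 2 * m + 2 ≤ k) :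
    (k + 1) ^ N * Nat.choose (m + N - 1) N ≤
      Nat.choose ((k - 1) * (m + N - 1) + N - 1) N := by
  have key : (k + 1) ^ N * m.ascFactorial N ≤
      ((k - 1) * (m + N - 1)).ascFactorial N := by
    apply pow_mul_ascFactorial_le (by omega)
    obtain ⟨d, rfl⟩ := Nat.exists_eq_add_of_le hN
    obtain ⟨t, rfl⟩ := Nat.exists_eq_add_of_le hk
    rw [show 2 * m + 2 + t - 1 = 2 * m + 1 + t by omega,
      show m + (3 + d) - 1 = m + 2 + d by omega, show 3 + d - 1 = 2 + d by omega]
    nlinarith [Nat.zero_le (m * d), Nat.zero_le (t * d)]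
  rw [Nat.ascFactorial_eq_factorial_mul_choose', Nat.ascFactorial_eq_factorial_mul_choose',
    mul_left_comm] at key
  exact Nat.le_of_mul_le_mul_left key N.factorial_pos
end

section
/- Let N ≥ 3, m ≥ 1 and k ≥ 2m+2 be integers and set x = (k−1)(m+N−1)+N−1. Then ∏_{i=1}^{k} (x+i) ≥ (k+1)(m+N) · ∏_{i=1}^{k−1} (x−N+i), i.e., (x+k)(x+k−1)⋯(x+1) ≥ (k+1)(m+N)(x−N+1)(x−N+2)⋯(x−N+k−1). -/
/-- A Bernoulli-type inequality for products of consecutive integers: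
`∏ (1 + N / (y + j)) ≥ 1 + n N / z` whenever `z ≥ y + n`, with denominators cleared. -/
theorem bernoulli_prod_range (N y z n : ℕ) (hz : y + n ≤ z) :
    (z + n * N) * ∏ j ∈ Finset.range n, (y + j) ≤
      z * ∏ j ∈ Finset.range n, (y + N + j) := by
  induction n with
  | zero => simp
  | succ n ih =>
    have h := ih (by omega)
    rw [Finset.prod_range_succ, Finset.prod_range_succ]
    have hfac : (z + (n + 1) * N) * (y + n) ≤ (z + n * N) * (y + N + n) := by
      have hyz : N * (y + n) ≤ N * (z + n * N) := Nat.mul_le_mul_left _ (by omega)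
      linarith
    calc (z + (n + 1) * N) * ((∏ j ∈ Finset.range n, (y + j)) * (y + n))
        = (z + (n + 1) * N) * (y + n) * ∏ j ∈ Finset.range n, (y + j) := by ring
      _ ≤ (z + n * N) * (y + N + n) * ∏ j ∈ Finset.range n, (y + j) :=
          Nat.mul_le_mul_right _ hfac
      _ = (z + n * N) * (∏ j ∈ Finset.range n, (y + j)) * (y + N + n) := by ring
      _ ≤ z * (∏ j ∈ Finset.range n, (y + N + j)) * (y + N + n) := Nat.mul_le_mul_right _ h
      _ = z * ((∏ j ∈ Finset.range n, (y + N + j)) * (y + N + n)) := by ring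

theorem prod_Icc_one_eq_prod_range (f : ℕ → ℕ) (n : ℕ) :
    ∏ i ∈ Finset.Icc 1 n, f i = ∏ j ∈ Finset.range n, f (j + 1) := by
  induction n with
  | zero => simp
  | succ n ih => rw [Finset.prod_Icc_succ_top (by omega), ih, Finset.prod_range_succ]

/-- For `N ≥ 3`, `m ≥ 1`, `k ≥ 2m+2` and `x = (k−1)(m+N−1)+N−1`:
`(x+k)(x+k−1)⋯(x+1) ≥ (k+1)(m+N)(x−N+1)(x−N+2)⋯(x−N+k−1)`. -/
theorem stmt_3 (N m k : ℕ) (hN : 3 ≤ N) (hm : 1 ≤ m) (hk : 2 * m + 2 ≤ k) :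
    (k + 1) * (m + N) * ∏ i ∈ Finset.Icc 1 (k - 1), ((k - 1) * (m + N - 1) + N - 1 - N + i) ≤
      ∏ i ∈ Finset.Icc 1 k, ((k - 1) * (m + N - 1) + N - 1 + i) := by
  obtain ⟨n, rfl⟩ : ∃ n, k = n + 1 := ⟨k - 1, by omega⟩
  obtain ⟨A, hA⟩ : ∃ A, m + N = A + 1 := ⟨m + N - 1, by omega⟩
  rw [prod_Icc_one_eq_prod_range, prod_Icc_one_eq_prod_range, hA]
  simp only [Nat.add_sub_cancel]
  have hy : 0 < n * A := Nat.mul_pos (by omega) (by omega)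
  obtain ⟨y, hyA⟩ : ∃ y, y = n * A := ⟨_, rfl⟩
  rw [← hyA] at hy ⊢
  have hlow : ∀ j, y + N - 1 - N + (j + 1) = y + j := fun j => by omega
  have hhigh : ∀ j, y + N - 1 + (j + 1) = y + N + j := fun j => by omega
  simp only [hlow, hhigh]
  rw [Finset.prod_range_succ]
  have h := bernoulli_prod_range N y (y + n) n le_rfl
  have hnN : 2 * m + N ≤ n * N := by
    have : (2 * m + 1) * N ≤ n * N := Nat.mul_le_mul_right _ (by omega)
    nlinarith
  have hcoef : (n + 1 + 1) * (A + 1) = y + n + (2 * m + 2 * N) := by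
    have : (n + 1 + 1) * (A + 1) = n * A + n + 2 * (A + 1) := by ring
    rw [this, ← hyA, ← hA]; ring
  have hfac : (y + n) * (y + n + (2 * m + 2 * N)) ≤ (y + n + n * N) * (y + N + n) := by
    have h1 : (y + n) * (2 * m + N) ≤ (y + n) * (n * N) := Nat.mul_le_mul_left _ hnN
    have h2 : 0 ≤ n * N * N := Nat.zero_le _
    linarith
  refine Nat.le_of_mul_le_mul_left (c := y + n) ?_ (by omega)
  rw [hcoef]
  calc (y + n) * ((y + n + (2 * m + 2 * N)) * ∏ j ∈ Finset.range n, (y + j))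
      = (y + n) * (y + n + (2 * m + 2 * N)) * ∏ j ∈ Finset.range n, (y + j) := by ring
    _ ≤ (y + n + n * N) * (y + N + n) * ∏ j ∈ Finset.range n, (y + j) :=
        Nat.mul_le_mul_right _ hfac
    _ = (y + n + n * N) * (∏ j ∈ Finset.range n, (y + j)) * (y + N + n) := by ring
    _ ≤ (y + n) * (∏ j ∈ Finset.range n, (y + N + j)) * (y + N + n) :=
        Nat.mul_le_mul_right _ h
    _ = (y + n) * ((∏ j ∈ Finset.range n, (y + N + j)) * (y + N + n)) := by ring
end

section
/- For all integers N ≥ 4, m ≥ 1 and k ≥ 2m+1, the binomial coefficient inequality C((k−1)(m+N−1)+N−1, N) ≥ (k+1)^N · C(m+N−1, N) holds, where C(a,b) denotes the binomial coefficient a choose b. -/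
open Finset in
/-- The square of a rising product, with the factors paired symmetrically. -/
theorem ascFactorial_sq (a N : ℕ) :
    a.ascFactorial N ^ 2 = ∏ j ∈ range N, (a + j) * (a + (N - 1 - j)) := by
  rw [prod_mul_distrib, prod_range_reflect (fun j => a + j) N, Nat.ascFactorial_eq_prod_range, sq]

open Finset in
theorem pow_le_ascFactorial_sq (a n : ℕ) :
    (a * (a + n)) ^ (n + 1) ≤ a.ascFactorial (n + 1) ^ 2 := by
  rw [ascFactorial_sq]
  conv_lhs => rw [← card_range (n + 1), ← prod_const]
  refine prod_le_prod (fun _ _ => Nat.zero_le _) (fun j hj => ?_)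
  obtain ⟨i, rfl⟩ := Nat.exists_eq_add_of_le (Nat.lt_succ_iff.mp (mem_range.mp hj))
  rw [Nat.add_sub_cancel, Nat.add_sub_cancel_left]
  nlinarith [Nat.zero_le (j * i)]

open Finset in
theorem four_pow_mul_ascFactorial_sq_le (a n : ℕ) :
    4 ^ (n + 1) * a.ascFactorial (n + 1) ^ 2 ≤ ((2 * a + n) ^ 2) ^ (n + 1) := by
  rw [ascFactorial_sq]
  conv_lhs => rw [← card_range (n + 1), ← prod_const, card_range, ← prod_mul_distrib]
  conv_rhs => rw [← card_range (n + 1), ← prod_const]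
  refine prod_le_prod (fun _ _ => Nat.zero_le _) (fun j hj => ?_)
  obtain ⟨i, rfl⟩ := Nat.exists_eq_add_of_le (Nat.lt_succ_iff.mp (mem_range.mp hj))
  rw [Nat.add_sub_cancel, Nat.add_sub_cancel_left]
  zify
  nlinarith [sq_nonneg ((j : ℤ) - i)]

/-- A pairwise comparison of the symmetric factors suffices for the comparison of the products. -/
theorem pow_mul_ascFactorial_le_of_sq_le {a b c n : ℕ}
    (h : c ^ 2 * (2 * a + n) ^ 2 ≤ 4 * (b * (b + n))) :
    c ^ (n + 1) * a.ascFactorial (n + 1) ≤ b.ascFactorial (n + 1) := by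
  rw [← Nat.pow_le_pow_iff_left two_ne_zero]
  refine Nat.le_of_mul_le_mul_left ?_ (pow_pos (Nat.succ_pos 3) (n + 1))
  calc 4 ^ (n + 1) * (c ^ (n + 1) * a.ascFactorial (n + 1)) ^ 2
      = (c ^ 2) ^ (n + 1) * (4 ^ (n + 1) * a.ascFactorial (n + 1) ^ 2) := by ring
    _ ≤ (c ^ 2) ^ (n + 1) * ((2 * a + n) ^ 2) ^ (n + 1) :=
      Nat.mul_le_mul_left _ (four_pow_mul_ascFactorial_sq_le a n)
    _ = (c ^ 2 * (2 * a + n) ^ 2) ^ (n + 1) := (mul_pow _ _ _).symm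
    _ ≤ (4 * (b * (b + n))) ^ (n + 1) := Nat.pow_le_pow_left h _
    _ = 4 ^ (n + 1) * (b * (b + n)) ^ (n + 1) := mul_pow _ _ _
    _ ≤ 4 ^ (n + 1) * b.ascFactorial (n + 1) ^ 2 :=
      Nat.mul_le_mul_left _ (pow_le_ascFactorial_sq b n)

theorem sq_mul_sq_le {m n c : ℕ} (hn : 3 ≤ n) (hm : 1 ≤ m) (hc : 2 * m ≤ c)
    (h : 2 ≤ m ∨ 3 ≤ c ∨ 5 ≤ n) :
    (c + 2) ^ 2 * (2 * m + n) ^ 2 ≤ 4 * (c * (m + n) * (c * (m + n) + n)) := by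
  obtain ⟨d, rfl⟩ := Nat.exists_eq_add_of_le hc
  obtain hm2 | rfl : 2 ≤ m ∨ m = 1 := by omega
  · obtain ⟨a, rfl⟩ := Nat.exists_eq_add_of_le hn
    obtain ⟨b, rfl⟩ := Nat.exists_eq_add_of_le hm2
    zify
    rw [← sub_nonneg]
    ring_nf
    positivity
  · obtain hd | rfl : 1 ≤ d ∨ d = 0 := by omega
    · obtain ⟨a, rfl⟩ := Nat.exists_eq_add_of_le hn
      obtain ⟨e, rfl⟩ := Nat.exists_eq_add_of_le hd
      zify
      rw [← sub_nonneg]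
      ring_nf
      positivity
    · obtain ⟨a, rfl⟩ := Nat.exists_eq_add_of_le (show 5 ≤ n by omega)
      zify
      rw [← sub_nonneg]
      ring_nf
      positivity

/-- For all integers `N ≥ 4`, `m ≥ 1` and `k ≥ 2m+1`,
`C((k−1)(m+N−1)+N−1, N) ≥ (k+1)^N · C(m+N−1, N)`. -/
theorem stmt_4 (N m k : ℕ) (hN : 4 ≤ N) (hm : 1 ≤ m) (hk : 2 * m + 1 ≤ k) :
    (k + 1) ^ N * Nat.choose (m + N - 1) N ≤
      Nat.choose ((k - 1) * (m + N - 1) + N - 1) N := by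
  obtain ⟨n, rfl⟩ : ∃ n, N = n + 1 := ⟨N - 1, by omega⟩
  obtain ⟨c, rfl⟩ : ∃ c, k = c + 1 := ⟨k - 1, by omega⟩
  refine Nat.le_of_mul_le_mul_left ?_ (n + 1).factorial_pos
  rw [mul_left_comm, ← Nat.ascFactorial_eq_factorial_mul_choose',
    ← Nat.ascFactorial_eq_factorial_mul_choose', Nat.add_sub_cancel, ← Nat.add_assoc m,
    Nat.add_sub_cancel]
  by_cases h : 2 ≤ m ∨ 3 ≤ c ∨ 5 ≤ n
  · exact pow_mul_ascFactorial_le_of_sq_le (sq_mul_sq_le (by omega) hm (by omega) h)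
  · obtain rfl : m = 1 := by omega
    obtain rfl : c = 2 := by omega
    obtain rfl | rfl : n = 3 ∨ n = 4 := by omega
    all_goals decide
end

section
/- Let N and m be integers such that either (N ≥ 4 and m ≥ 3) or (N ≥ 5 and m ≥ 2). Then for every integer k ≥ 2m, the binomial coefficient inequality C((k−1)(m+N−1)+N−1, N) ≥ (k+1)^N · C(m+N−1, N) holds, where C(a,b) denotes the binomial coefficient a choose b. -/
/-- If twice the mean of `A + i` and `A + j` dominates `c` times that of `m + i` and `m + j`,
the products compare as well, because scaling by `c` only widens the gap between the factors. -/
theorem sq_mul_mul_le_mul_of_mul_add_le {A c m i j : ℕ} (hc : 1 ≤ c)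
    (h : c * (2 * m + (i + j)) ≤ 2 * A + (i + j)) :
    c ^ 2 * ((m + i) * (m + j)) ≤ (A + i) * (A + j) := by
  have hsq := Nat.pow_le_pow_left h 2
  zify at hc hsq ⊢
  have hgap : (0 : ℤ) ≤ ((c : ℤ) ^ 2 - 1) * ((i : ℤ) - j) ^ 2 :=
    mul_nonneg (by nlinarith) (sq_nonneg _)
  linarith

theorem pow_mul_ascFactorial_le_ascFactorial {A c m N : ℕ} (hc : 1 ≤ c)
    (h : c * (2 * m + (N - 1)) ≤ 2 * A + (N - 1)) :
    c ^ N * m.ascFactorial N ≤ A.ascFactorial N := by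
  have hsq (a : ℕ) : a.ascFactorial N ^ 2 =
      ∏ i ∈ Finset.range N, (a + i) * (a + (N - 1 - i)) := by
    rw [Finset.prod_mul_distrib, Finset.prod_range_reflect (fun i => a + i) N,
      ← Nat.ascFactorial_eq_prod_range, sq]
  refine (Nat.pow_le_pow_iff_left two_ne_zero).1 ?_
  calc (c ^ N * m.ascFactorial N) ^ 2
      = ∏ i ∈ Finset.range N, c ^ 2 * ((m + i) * (m + (N - 1 - i))) := by
        rw [mul_pow, hsq, Finset.prod_mul_distrib (f := fun _ => c ^ 2), Finset.prod_const,
          Finset.card_range, pow_right_comm]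
    _ ≤ ∏ i ∈ Finset.range N, (A + i) * (A + (N - 1 - i)) := by
        refine Finset.prod_le_prod' fun i hi => sq_mul_mul_le_mul_of_mul_add_le hc ?_
        have hi' := Finset.mem_range.1 hi
        rwa [show i + (N - 1 - i) = N - 1 by omega]
    _ = A.ascFactorial N ^ 2 := (hsq A).symm

/-- If `(N ≥ 4 and m ≥ 3)` or `(N ≥ 5 and m ≥ 2)`, then for every `k ≥ 2m`,
`C((k−1)(m+N−1)+N−1, N) ≥ (k+1)^N · C(m+N−1, N)`. -/
theorem stmt_5 (N m : ℕ) (hNm : (4 ≤ N ∧ 3 ≤ m) ∨ (5 ≤ N ∧ 2 ≤ m)) :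
    ∀ k : ℕ, 2 * m ≤ k →
      (k + 1) ^ N * Nat.choose (m + N - 1) N ≤
        Nat.choose ((k - 1) * (m + N - 1) + N - 1) N := by
  intro k hk
  have hmean : (k + 1) * (2 * m + (N - 1)) ≤ 2 * ((k - 1) * (m + N - 1)) + (N - 1) := by
    obtain ⟨d, rfl⟩ : ∃ d, N = d + 1 := ⟨N - 1, by omega⟩
    obtain ⟨t, rfl⟩ : ∃ t, k = t + 2 := ⟨k - 2, by omega⟩
    have hdt : 4 * m ≤ d * t := by
      rcases hNm with ⟨hN, hm⟩ | ⟨hN, hm⟩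
      · have := Nat.mul_le_mul (show 3 ≤ d by omega) (le_refl t)
        omega
      · have := Nat.mul_le_mul (show 4 ≤ d by omega) (le_refl t)
        omega
    simp only [← Nat.add_assoc, Nat.add_sub_cancel, show t + 2 - 1 = t + 1 by omega]
    linarith
  have hasc := pow_mul_ascFactorial_le_ascFactorial (Nat.le_add_left 1 k) hmean
  rw [Nat.ascFactorial_eq_factorial_mul_choose', Nat.ascFactorial_eq_factorial_mul_choose',
    mul_left_comm] at hasc
  exact Nat.le_of_mul_le_mul_left hasc N.factorial_pos
end

section
/- Let k be a field, R = k[x_0,…,x_N] with maximal homogeneous ideal 𝔪 = (x_0,…,x_N), and let 1 ≤ h ≤ N and n ≥ h be integers. Let F_1,…,F_n ∈ R be homogeneous polynomials such that any subset of at most h+1 of them forms a complete intersection (i.e., a regular sequence on R), and let I = ⋂_{1 ≤ i_1 < … < i_h ≤ n} (F_{i_1},…,F_{i_h}) be the defining ideal of the corresponding codimension-h star configuration. Then for all integers m, r, c ≥ 1 one has the containment I^{(r(m+h−1)−h+c)} ⊆ 𝔪^{(r−1)(h−1)+c−1} · (I^{(m)})^r. -/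
section PermutableRegular

variable {R ι : Type*} [CommRing R]

/-- The ideal generated by the powers `F i ^ e i`, for `i ∈ S`. -/
def powIdeal (F : ι → R) (S : Finset ι) (e : ι → ℕ) : Ideal R :=
  Ideal.span ((fun i => F i ^ e i) '' (S : Set ι))

theorem pow_mem_powIdeal (F : ι → R) {S : Finset ι} {e : ι → ℕ} {i : ι} (hi : i ∈ S) :
    F i ^ e i ∈ powIdeal F S e :=
  Ideal.subset_span ⟨i, hi, rfl⟩

theorem powIdeal_congr (F : ι → R) {S : Finset ι} {e e' : ι → ℕ} (H : ∀ i ∈ S, e i = e' i) :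
    powIdeal F S e = powIdeal F S e' := by
  unfold powIdeal
  congr 1
  exact Set.image_congr fun i hi => by rw [H i hi]

theorem powIdeal_one (F : ι → R) {S : Finset ι} {e : ι → ℕ} (H : ∀ i ∈ S, e i = 1) :
    powIdeal F S e = Ideal.span (F '' (S : Set ι)) := by
  unfold powIdeal
  congr 1
  exact Set.image_congr fun i hi => by rw [H i hi, pow_one]

theorem mem_powIdeal_iff_erase [DecidableEq ι] (F : ι → R) {S : Finset ι} {e : ι → ℕ} {t : ι}
    (ht : t ∈ S) {x : R} :
    x ∈ powIdeal F S e ↔ ∃ u, x + u * F t ^ e t ∈ powIdeal F (S.erase t) e := by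
  unfold powIdeal
  conv_lhs => rw [← Finset.insert_erase ht, Finset.coe_insert, Set.image_insert_eq]
  rw [Ideal.mem_span_insert']

/-- Every `F j` is a nonzerodivisor modulo any at most `h` other members of the family `F`. -/
def IsPermutableRegular (F : ι → R) (h : ℕ) : Prop :=
  ∀ T : Finset ι, T.card ≤ h → ∀ j ∉ T, ∀ y,
    F j * y ∈ Ideal.span (F '' (T : Set ι)) → y ∈ Ideal.span (F '' (T : Set ι))

variable {F : ι → R} {h : ℕ}

theorem IsPermutableRegular.mem_powIdeal [DecidableEq ι] (hF : IsPermutableRegular F h)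
    {T : Finset ι} {e : ι → ℕ} (hT : T.card ≤ h) (he : ∀ i ∈ T, 1 ≤ e i) {j : ι} (hj : j ∉ T)
    {y : R} (hy : F j * y ∈ powIdeal F T e) : y ∈ powIdeal F T e := by
  induction hN : ∑ i ∈ T, e i using Nat.strong_induction_on generalizing T e j y with
  | _ N ih =>
  by_cases h1 : ∀ i ∈ T, e i = 1
  · rw [powIdeal_one F h1] at hy ⊢
    exact hF T hT j hj y hy
  push Not at h1
  obtain ⟨t, ht, het⟩ := h1
  obtain ⟨p, hp⟩ : ∃ p, e t = p + 1 := ⟨e t - 1, by have := he t ht; omega⟩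
  have hp1 : 1 ≤ p := by omega
  have hsum : ∑ i ∈ T.erase t, e i + e t = ∑ i ∈ T, e i := Finset.sum_erase_add _ _ ht
  have hupd : ∀ q, powIdeal F (T.erase t) (Function.update e t q) = powIdeal F (T.erase t) e :=
    fun q => powIdeal_congr F fun i hi => by
      rw [Function.update_of_ne (Finset.ne_of_mem_erase hi)]
  have hmem : ∀ q x, x ∈ powIdeal F T (Function.update e t q) ↔
      ∃ u, x + u * F t ^ q ∈ powIdeal F (T.erase t) e := fun q x => by
    rw [mem_powIdeal_iff_erase F ht, hupd, Function.update_self]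
  have hreg : ∀ q, 1 ≤ q → q ≤ p → ∀ x, F j * x ∈ powIdeal F T (Function.update e t q) →
      x ∈ powIdeal F T (Function.update e t q) := fun q hq hqp x hx => by
    refine ih _ ?_ hT ?_ hj hx rfl
    · have := Finset.sum_erase_add T (Function.update e t q) ht
      rw [Function.update_self, Finset.sum_congr rfl (g := fun i => e i) fun i hi => by
        rw [Function.update_of_ne (Finset.ne_of_mem_erase hi)]] at this
      omega
    · intro i hi
      by_cases hit : i = t
      · subst hit
        rwa [Function.update_self]
      · rw [Function.update_of_ne hit]
        exact he i hi
  have herase : ∀ x, F t * x ∈ powIdeal F (T.erase t) e → x ∈ powIdeal F (T.erase t) e :=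
    fun x hx => ih _ (by omega) ((Finset.card_erase_le).trans hT)
      (fun i hi => he i (Finset.mem_of_mem_erase hi)) (Finset.notMem_erase t T) hx rfl
  have herase_pow : ∀ q x, F t ^ q * x ∈ powIdeal F (T.erase t) e →
      x ∈ powIdeal F (T.erase t) e := fun q => by
    induction q with
    | zero => intro x hx; simpa using hx
    | succ q ihq => intro x hx; exact ihq x (herase _ (by rwa [← mul_assoc, ← pow_succ']))
  obtain ⟨v, hv⟩ := (mem_powIdeal_iff_erase F ht).1 hy
  rw [hp] at hv
  obtain ⟨u, hu⟩ := (hmem p y).1 (hreg p hp1 le_rfl y ((hmem p _).2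
    ⟨v * F t, by convert hv using 1; ring⟩))
  have hw : F j * u ∈ powIdeal F T (Function.update e t 1) := by
    refine (hmem 1 _).2 ⟨-v, herase_pow p _ ?_⟩
    convert Ideal.sub_mem _ (Ideal.mul_mem_left _ (F j) hu) hv using 1
    ring
  obtain ⟨w, hw⟩ := (hmem 1 _).1 (hreg 1 le_rfl hp1 u hw)
  refine (mem_powIdeal_iff_erase F ht).2 ⟨-w, ?_⟩
  rw [hp]
  convert Ideal.sub_mem _ hu (Ideal.mul_mem_left _ (F t ^ p) hw) using 1
  ring

theorem IsPermutableRegular.mem_powIdeal_of_pow_mul [DecidableEq ι]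
    (hF : IsPermutableRegular F h) {T : Finset ι} {e : ι → ℕ} (hT : T.card ≤ h)
    (he : ∀ i ∈ T, 1 ≤ e i) {j : ι} (hj : j ∉ T) (q : ℕ) {y : R}
    (hy : F j ^ q * y ∈ powIdeal F T e) : y ∈ powIdeal F T e := by
  induction q generalizing y with
  | zero => simpa using hy
  | succ q ih => exact ih (hF.mem_powIdeal hT he hj (by rwa [← mul_assoc, ← pow_succ']))

theorem IsPermutableRegular.mem_powIdeal_of_prod_mul [DecidableEq ι]
    (hF : IsPermutableRegular F h) {T : Finset ι} {e : ι → ℕ} (hT : T.card ≤ h)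
    (he : ∀ i ∈ T, 1 ≤ e i) (a : ι → ℕ) (U : Finset ι) (hU : Disjoint U T) {y : R}
    (hy : (∏ i ∈ U, F i ^ a i) * y ∈ powIdeal F T e) : y ∈ powIdeal F T e := by
  induction U using Finset.induction_on generalizing y with
  | empty => simpa using hy
  | insert j U hj ih =>
    rw [Finset.prod_insert hj, mul_assoc] at hy
    rw [Finset.disjoint_insert_left] at hU
    exact ih hU.2 (hF.mem_powIdeal_of_pow_mul hT he hU.1 _ hy)

theorem IsPermutableRegular.mem_span_of_prod_mul_mem_powIdeal [DecidableEq ι]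
    (hF : IsPermutableRegular F h) {T : Finset ι} (hT : T.card ≤ h) (a : ι → ℕ) {y : R}
    (hy : (∏ i ∈ T, F i ^ a i) * y ∈ powIdeal F T (fun i => a i + 1)) :
    y ∈ Ideal.span (F '' (T : Set ι)) := by
  have key : ∀ U ⊆ T, ∀ y,
      (∏ i ∈ U, F i ^ a i) * y ∈ powIdeal F T (fun i => if i ∈ U then a i + 1 else 1) →
      y ∈ Ideal.span (F '' (T : Set ι)) := by
    intro U
    induction U using Finset.induction_on with
    | empty =>
      intro _ y hy
      rwa [powIdeal_one F (by simp), Finset.prod_empty, one_mul] at hy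
    | insert t U ht ih =>
      intro hUT y hy
      have htT : t ∈ T := hUT (Finset.mem_insert_self t U)
      refine ih ((Finset.subset_insert t U).trans hUT) y ?_
      rw [mem_powIdeal_iff_erase F htT] at hy ⊢
      obtain ⟨u, hu⟩ := hy
      have hc : powIdeal F (T.erase t) (fun i => if i ∈ insert t U then a i + 1 else 1) =
          powIdeal F (T.erase t) (fun i => if i ∈ U then a i + 1 else 1) :=
        powIdeal_congr F fun i hi => by simp [Finset.ne_of_mem_erase hi]
      rw [hc] at hu
      refine ⟨u, ?_⟩
      refine hF.mem_powIdeal_of_pow_mul ((Finset.card_erase_le).trans hT)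
        (fun i _ => by split_ifs <;> omega) (Finset.notMem_erase t T) (a t) ?_
      convert hu using 1
      rw [Finset.prod_insert ht]
      simp only [Finset.mem_insert_self, if_true, if_neg ht]
      ring
  refine key T subset_rfl y ?_
  rwa [powIdeal_congr F (e' := fun i => a i + 1) fun i hi => by rw [if_pos hi]]

theorem IsPermutableRegular.mem_span_of_prod_univ_mul_mem_powIdeal [Fintype ι] [DecidableEq ι]
    (hF : IsPermutableRegular F h) {T : Finset ι} (hT : T.card ≤ h) (a : ι → ℕ) {y : R}
    (hy : (∏ i, F i ^ a i) * y ∈ powIdeal F T (fun i => a i + 1)) :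
    y ∈ Ideal.span (F '' (T : Set ι)) := by
  rw [← Finset.prod_mul_prod_compl T, mul_comm (∏ i ∈ T, _), mul_assoc] at hy
  exact hF.mem_span_of_prod_mul_mem_powIdeal hT a (hF.mem_powIdeal_of_prod_mul hT
    (fun i _ => by omega) a Tᶜ disjoint_compl_left hy)

theorem span_pow_le_powIdeal [DecidableEq ι] (F : ι → R) (S : Finset ι) (c : ι → ℕ) (M : ℕ)
    (hc : ∑ i ∈ S, c i < M) :
    Ideal.span (F '' (S : Set ι)) ^ M ≤ powIdeal F S (fun i => c i + 1) := by
  induction M generalizing c with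
  | zero => omega
  | succ M ih =>
    rw [pow_succ', Ideal.mul_le]
    intro x hx y hy
    induction hx using Submodule.span_induction with
    | zero => simp
    | add x x' _ _ hx hx' => rw [add_mul]; exact Ideal.add_mem _ hx hx'
    | smul r x _ hx => rw [smul_eq_mul, mul_assoc]; exact Ideal.mul_mem_left _ _ hx
    | mem x hx =>
      obtain ⟨t, ht, rfl⟩ := hx
      have ht : t ∈ S := ht
      rw [mem_powIdeal_iff_erase F ht]
      obtain h0 | h0 := Nat.eq_zero_or_pos (c t)
      · exact ⟨-y, by simp [h0, mul_comm]⟩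
      obtain ⟨p, hp⟩ : ∃ p, c t = p + 1 := ⟨c t - 1, by omega⟩
      have hsum := Finset.sum_erase_add S c ht
      have hsum' := Finset.sum_erase_add S (Function.update c t p) ht
      rw [Function.update_self, Finset.sum_congr rfl (g := fun i => c i) fun i hi => by
        rw [Function.update_of_ne (Finset.ne_of_mem_erase hi)]] at hsum'
      have hy' := ih (Function.update c t p) (by omega) hy
      rw [mem_powIdeal_iff_erase F ht] at hy'
      obtain ⟨u, hu⟩ := hy'
      rw [powIdeal_congr F (e' := fun i => c i + 1) fun i hi => by
        rw [Function.update_of_ne (Finset.ne_of_mem_erase hi)]] at hu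
      rw [Function.update_self] at hu
      refine ⟨u, ?_⟩
      rw [hp]
      convert Ideal.mul_mem_left _ (F t) hu using 1
      ring

end PermutableRegular

section MonomialFiltration

variable {R : Type*} [CommRing R] {n : ℕ}

/-- The monomial with exponent vector `a` in the elements `F i`. -/
def familyMonomial (F : Fin n → R) (a : Fin n → ℕ) : R :=
  ∏ i, F i ^ a i

theorem familyMonomial_add (F : Fin n → R) (a b : Fin n → ℕ) :
    familyMonomial F (a + b) = familyMonomial F a * familyMonomial F b := by
  simp [familyMonomial, pow_add, Finset.prod_mul_distrib]

theorem familyMonomial_nsmul (F : Fin n → R) (r : ℕ) (a : Fin n → ℕ) :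
    familyMonomial F (r • a) = familyMonomial F a ^ r := by
  simp [familyMonomial, pow_mul', Finset.prod_pow]

theorem familyMonomial_single (F : Fin n → R) (i : Fin n) :
    familyMonomial F (Pi.single i 1) = F i := by
  rw [familyMonomial, Finset.prod_eq_single i]
  · simp
  · intro j _ hj
    simp [hj]
  · simp

theorem familyMonomial_mem_of_le (F : Fin n → R) {a b : Fin n → ℕ} (hab : a ≤ b) {J : Ideal R}
    (ha : familyMonomial F a ∈ J) : familyMonomial F b ∈ J := by
  rw [← tsub_add_cancel_of_le hab, familyMonomial_add]
  exact Ideal.mul_mem_left _ _ ha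

theorem familyMonomial_mem_powIdeal (F : Fin n → R) {S : Finset (Fin n)} {a e : Fin n → ℕ}
    {i : Fin n} (hi : i ∈ S) (hle : e i ≤ a i) : familyMonomial F a ∈ powIdeal F S e := by
  rw [familyMonomial, ← Finset.mul_prod_erase _ _ (Finset.mem_univ i)]
  exact Ideal.mul_mem_right _ _ (Ideal.mem_of_dvd _ (pow_dvd_pow _ hle) (pow_mem_powIdeal F hi))

/-- The exponents of degree at least `M` in every choice of `h` variables. -/
def starExponents (n h M : ℕ) : Set (Fin n → ℕ) :=
  {a | ∀ T : Finset (Fin n), T.card = h → M ≤ ∑ i ∈ T, a i}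

/-- A total refinement of the degree in the variables of `T`: the powers of two break ties
between different sets `T`. -/
def tieWeight (T : Finset (Fin n)) (a : Fin n → ℕ) : ℕ :=
  ∑ i ∈ T, (2 ^ n * a i + 2 ^ (i : ℕ))

theorem tieWeight_eq (T : Finset (Fin n)) (a : Fin n → ℕ) :
    tieWeight T a = 2 ^ n * ∑ i ∈ T, a i + ∑ i ∈ T, 2 ^ (i : ℕ) := by
  rw [tieWeight, Finset.sum_add_distrib, Finset.mul_sum]

theorem sum_two_pow_lt (T : Finset (Fin n)) : ∑ i ∈ T, 2 ^ (i : ℕ) < 2 ^ n := by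
  have := Nat.geomSum_lt (m := 2) (n := n) (s := T.map Fin.valEmbedding) le_rfl (by simp)
  simpa using this

theorem sum_two_pow_injective {S T : Finset (Fin n)}
    (H : ∑ i ∈ S, 2 ^ (i : ℕ) = ∑ i ∈ T, 2 ^ (i : ℕ)) : S = T := by
  apply Finset.map_injective Fin.valEmbedding
  apply Finset.geomSum_injective (n := 2) le_rfl
  simpa using H

theorem sum_eq_and_eq_of_tieWeight_eq {S T : Finset (Fin n)} {a : Fin n → ℕ} {d : ℕ}
    (H : tieWeight T a = 2 ^ n * d + ∑ i ∈ S, 2 ^ (i : ℕ)) : T = S ∧ ∑ i ∈ T, a i = d := by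
  rw [tieWeight_eq] at H
  have hS := sum_two_pow_lt S
  have hT := sum_two_pow_lt T
  have h1 := congrArg (· % 2 ^ n) H
  have h2 := congrArg (· / 2 ^ n) H
  simp only [Nat.mul_add_mod, Nat.mod_eq_of_lt hS, Nat.mod_eq_of_lt hT] at h1
  simp only [Nat.mul_add_div (Nat.two_pow_pos n), Nat.div_eq_of_lt hS, Nat.div_eq_of_lt hT,
    add_zero] at h2
  exact ⟨sum_two_pow_injective h1, h2⟩

/-- The exponents all of whose tie-broken weights are at least `κ`. -/
def tieExponents (n h κ : ℕ) : Set (Fin n → ℕ) :=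
  {a | ∀ T : Finset (Fin n), T.card = h → κ ≤ tieWeight T a}

/-- The smallest exponent vector that agrees with `a` on `S` and exceeds it, in the tie-broken
order, off `S`. -/
noncomputable def reduceOff (S : Finset (Fin n)) (a : Fin n → ℕ) : Fin n → ℕ := fun j =>
  if j ∈ S then a j else
    sInf {t | ∀ i ∈ S, 2 ^ n * a i + 2 ^ (i : ℕ) ≤ 2 ^ n * t + 2 ^ (j : ℕ)}

theorem reduceOff_of_mem {S : Finset (Fin n)} (a : Fin n → ℕ) {j : Fin n} (hj : j ∈ S) :
    reduceOff S a j = a j :=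
  if_pos hj

theorem reduceOff_congr {S : Finset (Fin n)} {a b : Fin n → ℕ} (H : ∀ i ∈ S, a i = b i) :
    reduceOff S a = reduceOff S b := by
  funext j
  unfold reduceOff
  split_ifs with hj
  · exact H j hj
  · congr 1
    ext t
    exact forall₂_congr fun i hi => by rw [H i hi]

theorem reduceOff_idem (S : Finset (Fin n)) (a : Fin n → ℕ) :
    reduceOff S (reduceOff S a) = reduceOff S a :=
  reduceOff_congr fun _ hi => reduceOff_of_mem a hi

theorem tieWeight_reduceOff (S : Finset (Fin n)) (a : Fin n → ℕ) :
    tieWeight S (reduceOff S a) = tieWeight S a :=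
  Finset.sum_congr rfl fun i hi => by rw [reduceOff_of_mem a hi]

theorem weight_le_of_mem_of_notMem {h κ : ℕ} {S : Finset (Fin n)} (hS : S.card = h)
    {a : Fin n → ℕ} (ha : a ∈ tieExponents n h κ) (haS : tieWeight S a = κ) {i j : Fin n}
    (hi : i ∈ S) (hj : j ∉ S) :
    2 ^ n * a i + 2 ^ (i : ℕ) ≤ 2 ^ n * a j + 2 ^ (j : ℕ) := by
  have hj' : j ∉ S.erase i := fun hm => hj (Finset.mem_of_mem_erase hm)
  have hcard : (insert j (S.erase i)).card = h := by
    rw [Finset.card_insert_of_notMem hj', Finset.card_erase_add_one hi, hS]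
  have h1 := ha _ hcard
  rw [tieWeight, Finset.sum_insert hj'] at h1
  have h2 := Finset.sum_erase_add S (fun i => 2 ^ n * a i + 2 ^ (i : ℕ)) hi
  rw [tieWeight] at haS
  omega

theorem reduceOff_le {h κ : ℕ} {S : Finset (Fin n)} (hS : S.card = h)
    {a : Fin n → ℕ} (ha : a ∈ tieExponents n h κ) (haS : tieWeight S a = κ) :
    reduceOff S a ≤ a := by
  intro j
  unfold reduceOff
  split_ifs with hj
  · exact le_rfl
  · exact Nat.sInf_le fun i hi => weight_le_of_mem_of_notMem hS ha haS hi hj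

theorem sum_le_sum_of_card_eq {ι : Type*} [DecidableEq ι] {S T : Finset ι} (hST : S.card = T.card)
    {f : ι → ℕ} (hf : ∀ i ∈ S, ∀ j ∉ S, f i ≤ f j) : ∑ i ∈ S, f i ≤ ∑ i ∈ T, f i := by
  rw [← Finset.sum_inter_add_sum_sdiff S T f, ← Finset.sum_inter_add_sum_sdiff T S f,
    Finset.inter_comm T S]
  have hcard : (S \ T).card = (T \ S).card := Finset.card_sdiff_comm hST
  refine Nat.add_le_add_left ?_ _
  calc ∑ i ∈ S \ T, f i ≤ (S \ T).card • (S.sup f) :=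
        Finset.sum_le_card_nsmul _ _ _ fun i hi => Finset.le_sup (Finset.mem_sdiff.1 hi).1
    _ = (T \ S).card • (S.sup f) := by rw [hcard]
    _ ≤ ∑ i ∈ T \ S, f i := Finset.card_nsmul_le_sum _ _ _ fun j hj =>
        Finset.sup_le fun i hi => hf i hi j (Finset.mem_sdiff.1 hj).2

theorem reduceOff_mem_tieExponents {h κ : ℕ} {S : Finset (Fin n)} (hS : S.card = h)
    {a : Fin n → ℕ} (ha : a ∈ tieExponents n h κ) (haS : tieWeight S a = κ) :
    reduceOff S a ∈ tieExponents n h κ := by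
  intro T hT
  rw [← haS, ← tieWeight_reduceOff]
  refine sum_le_sum_of_card_eq (hS.trans hT.symm) fun i hi j hj => ?_
  rw [reduceOff_of_mem a hi]
  have hne : {t | ∀ i ∈ S, 2 ^ n * a i + 2 ^ (i : ℕ) ≤ 2 ^ n * t + 2 ^ (j : ℕ)}.Nonempty :=
    ⟨a j, fun i hi => weight_le_of_mem_of_notMem hS ha haS hi hj⟩
  have := Nat.sInf_mem hne i hi
  rwa [reduceOff, if_neg hj]

/-- The ideal of all monomials in the `F i` whose tie-broken weights are at least `κ`. -/
def tieIdeal (F : Fin n → R) (h κ : ℕ) : Ideal R :=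
  Ideal.span (familyMonomial F '' tieExponents n h κ)

/-- The ideal of all monomials in the `F i` of degree at least `M` in every `h` variables. -/
def starIdeal (F : Fin n → R) (h M : ℕ) : Ideal R :=
  Ideal.span (familyMonomial F '' starExponents n h M)

theorem tieIdeal_zero (F : Fin n → R) (h : ℕ) : tieIdeal F h 0 = ⊤ := by
  rw [Ideal.eq_top_iff_one]
  exact Ideal.subset_span ⟨0, fun T _ => Nat.zero_le _, by simp [familyMonomial]⟩

theorem tieIdeal_le_starIdeal (F : Fin n → R) (h M : ℕ) :
    tieIdeal F h (2 ^ n * M) ≤ starIdeal F h M := by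
  refine Ideal.span_mono (Set.image_mono fun a ha T hT => ?_)
  have h1 := ha T hT
  rw [tieWeight_eq] at h1
  have h2 := sum_two_pow_lt T
  by_contra! h3
  have h4 : 2 ^ n * (∑ i ∈ T, a i + 1) ≤ 2 ^ n * M := Nat.mul_le_mul_left _ h3
  rw [mul_add] at h4
  omega

theorem mem_tieIdeal_succ_of_lt (F : Fin n → R) {h κ : ℕ} {a : Fin n → ℕ}
    (ha : ∀ T : Finset (Fin n), T.card = h → κ < tieWeight T a) :
    familyMonomial F a ∈ tieIdeal F h (κ + 1) :=
  Ideal.subset_span ⟨a, fun T hT => ha T hT, rfl⟩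

theorem tieIdeal_le_sup_span (F : Fin n → R) {h d : ℕ} {S : Finset (Fin n)} (hS : S.card = h)
    {κ : ℕ} (hκ : κ = 2 ^ n * d + ∑ i ∈ S, 2 ^ (i : ℕ)) :
    tieIdeal F h κ ≤ tieIdeal F h (κ + 1) ⊔ Ideal.span (familyMonomial F ''
      {c | c ∈ tieExponents n h κ ∧ tieWeight S c = κ ∧ reduceOff S c = c}) := by
  refine Ideal.span_le.2 ?_
  rintro _ ⟨a, ha, rfl⟩
  by_cases haS : tieWeight S a = κ
  · refine Ideal.mem_sup_right ?_
    refine familyMonomial_mem_of_le F (reduceOff_le hS ha haS)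
      (Ideal.subset_span ⟨_, ⟨?_, ?_, ?_⟩, rfl⟩)
    · exact reduceOff_mem_tieExponents hS ha haS
    · rw [tieWeight_reduceOff, haS]
    · exact reduceOff_idem S a
  · refine Ideal.mem_sup_left (mem_tieIdeal_succ_of_lt F fun T hT => ?_)
    refine lt_of_le_of_ne (ha T hT) fun heq => haS ?_
    rw [heq, (sum_eq_and_eq_of_tieWeight_eq (heq.symm.trans hκ)).1]

theorem span_mul_familyMonomial_mem (F : Fin n → R) {h d : ℕ} {S : Finset (Fin n)}
    {κ : ℕ} (hκ : κ = 2 ^ n * d + ∑ i ∈ S, 2 ^ (i : ℕ)) {c : Fin n → ℕ}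
    (hc : c ∈ tieExponents n h κ) {x : R} (hx : x ∈ Ideal.span (F '' (S : Set (Fin n)))) :
    x * familyMonomial F c ∈ tieIdeal F h (κ + 1) := by
  induction hx using Submodule.span_induction with
  | zero => simp
  | add x x' _ _ hx hx' => rw [add_mul]; exact Ideal.add_mem _ hx hx'
  | smul r x _ hx => rw [smul_eq_mul, mul_assoc]; exact Ideal.mul_mem_left _ _ hx
  | mem x hx =>
    obtain ⟨s, hs, rfl⟩ := hx
    have hs : s ∈ S := hs
    rw [← familyMonomial_single F s, ← familyMonomial_add]
    refine mem_tieIdeal_succ_of_lt F fun T hT => ?_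
    have h1 := hc T hT
    have h2 : tieWeight T (Pi.single s 1 + c) =
        tieWeight T c + 2 ^ n * ∑ i ∈ T, (Pi.single s 1 : Fin n → ℕ) i := by
      rw [tieWeight_eq, tieWeight_eq]
      simp only [Pi.add_apply, Finset.sum_add_distrib]
      ring
    by_cases hTS : T = S
    · subst hTS
      rw [h2, Finset.sum_pi_single', if_pos hs]
      have := Nat.two_pow_pos n
      omega
    · have h3 : κ ≠ tieWeight T c := fun heq =>
        hTS (sum_eq_and_eq_of_tieWeight_eq (heq.symm.trans hκ)).1
      omega

theorem tieIdeal_succ_le_powIdeal (F : Fin n → R) {h d : ℕ} {S : Finset (Fin n)}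
    (hS : S.card = h)
    {κ : ℕ} (hκ : κ = 2 ^ n * d + ∑ i ∈ S, 2 ^ (i : ℕ)) {c : Fin n → ℕ}
    (hcd : ∑ i ∈ S, c i = d) :
    tieIdeal F h (κ + 1) ≤ powIdeal F S (fun i => c i + 1) := by
  refine Ideal.span_le.2 ?_
  rintro _ ⟨a, ha, rfl⟩
  have h1 := ha S hS
  rw [tieWeight_eq, hκ] at h1
  have h2 : d < ∑ i ∈ S, a i := Nat.lt_of_mul_lt_mul_left (a := 2 ^ n) (by omega)
  rw [← hcd] at h2
  obtain ⟨i, hi, hlt⟩ := Finset.exists_lt_of_sum_lt h2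
  exact familyMonomial_mem_powIdeal F hi hlt

/-- The hypothesis on `f` says that `f` lies in `(F i : i ∈ S) ^ M` locally at all the associated
primes of `(F i : i ∈ S)`. -/
theorem mem_tieIdeal_succ {F : Fin n → R} {h : ℕ} (hF : IsPermutableRegular F h) {M : ℕ} {f : R}
    (hf : ∀ S : Finset (Fin n), S.card = h → ∀ z ∉ Ideal.span (F '' (S : Set (Fin n))),
      ∃ s, s * z ∉ Ideal.span (F '' (S : Set (Fin n))) ∧
        s * f ∈ Ideal.span (F '' (S : Set (Fin n))) ^ M)
    {κ : ℕ} (hκM : κ < 2 ^ n * M) (hfκ : f ∈ tieIdeal F h κ) : f ∈ tieIdeal F h (κ + 1) := by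
  by_cases hκ : ∃ S : Finset (Fin n), S.card = h ∧ ∃ d, κ = 2 ^ n * d + ∑ i ∈ S, 2 ^ (i : ℕ)
  swap
  · refine Ideal.span_mono (Set.image_mono fun a ha T hT => ?_) hfκ
    refine Nat.lt_of_le_of_ne (ha T hT) fun heq => hκ ⟨T, hT, ∑ i ∈ T, a i, ?_⟩
    rw [heq, tieWeight_eq]
  obtain ⟨S, hS, d, hκ⟩ := hκ
  have hdM : d < M := Nat.lt_of_mul_lt_mul_left (a := 2 ^ n) (by omega)
  obtain ⟨g, hg, p, hp, rfl⟩ := Submodule.mem_sup.1 (tieIdeal_le_sup_span F hS hκ hfκ)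
  obtain ⟨l, hl, rfl⟩ := (Finsupp.mem_span_image_iff_linearCombination R).1 hp
  rw [Finsupp.mem_supported] at hl
  rw [Finsupp.linearCombination_apply, Finsupp.sum] at hf ⊢
  refine Ideal.add_mem _ hg (Ideal.sum_mem _ fun c hc => ?_)
  obtain ⟨hcκ, hcS, hcr⟩ := hl hc
  rw [smul_eq_mul]
  refine span_mul_familyMonomial_mem F hκ hcκ ?_
  by_contra hlc
  obtain ⟨s, hs, hsf⟩ := hf S hS _ hlc
  have hcd := (sum_eq_and_eq_of_tieWeight_eq (hcS.trans hκ)).2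
  refine hs (hF.mem_span_of_prod_univ_mul_mem_powIdeal hS.le c ?_)
  change familyMonomial F c * (s * l c) ∈ _
  have h1 := span_pow_le_powIdeal F S c M (by omega) hsf
  rw [mul_add, Ideal.add_mem_iff_right _
    (Ideal.mul_mem_left _ s (tieIdeal_succ_le_powIdeal F hS hκ hcd hg)),
    ← Finset.add_sum_erase _ _ hc, mul_add, Ideal.add_mem_iff_left] at h1
  · convert h1 using 1
    rw [smul_eq_mul]
    ring
  refine Ideal.mul_mem_left _ s (Ideal.sum_mem _ fun c' hc' => ?_)
  obtain ⟨hne, hc'⟩ := Finset.mem_erase.1 hc'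
  obtain ⟨-, hcS', hcr'⟩ := hl hc'
  have hcd' := (sum_eq_and_eq_of_tieWeight_eq (hcS'.trans hκ)).2
  obtain ⟨i, hi, hlt⟩ : ∃ i ∈ S, c i < c' i := by
    by_contra! hle
    refine hne ?_
    rw [← hcr, ← hcr']
    exact reduceOff_congr ((Finset.sum_eq_sum_iff_of_le hle).1 (hcd'.trans hcd.symm))
  exact Ideal.mul_mem_left _ _ (familyMonomial_mem_powIdeal F hi hlt)

theorem mem_starIdeal {F : Fin n → R} {h : ℕ} (hF : IsPermutableRegular F h) {M : ℕ} {f : R}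
    (hf : ∀ S : Finset (Fin n), S.card = h → ∀ z ∉ Ideal.span (F '' (S : Set (Fin n))),
      ∃ s, s * z ∉ Ideal.span (F '' (S : Set (Fin n))) ∧
        s * f ∈ Ideal.span (F '' (S : Set (Fin n))) ^ M) : f ∈ starIdeal F h M := by
  have key : ∀ κ ≤ 2 ^ n * M, f ∈ tieIdeal F h κ := fun κ => by
    induction κ with
    | zero => intro _; rw [tieIdeal_zero]; trivial
    | succ κ ih => intro hκ; exact mem_tieIdeal_succ hF hf hκ (ih (Nat.le_of_succ_le hκ))
  exact tieIdeal_le_starIdeal F h M (key _ le_rfl)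

theorem exists_starExponents_sum_eq {h m r M : ℕ} (hhn : h ≤ n) (hm : 1 ≤ m) (hr : 1 ≤ r)
    (hM : r * m + h * (r - 1) < M + r) {a : Fin n → ℕ} (ha : a ∈ starExponents n h M) :
    ∃ b ∈ starExponents n h m, r • b ≤ a ∧
      ∃ S : Finset (Fin n), S.card = h ∧ ∑ i ∈ S, b i = m := by
  have hne : {b | b ∈ starExponents n h m ∧ r • b ≤ a}.Nonempty := by
    refine ⟨fun i => a i / r, fun T hT => ?_, fun i => Nat.mul_div_le _ _⟩
    have h1 : ∑ i ∈ T, a i ≤ ∑ i ∈ T, (r * (a i / r) + (r - 1)) :=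
      Finset.sum_le_sum fun i _ => by
        have := Nat.div_add_mod (a i) r
        have := Nat.mod_lt (a i) hr
        omega
    rw [Finset.sum_add_distrib, ← Finset.mul_sum, Finset.sum_const, hT, smul_eq_mul] at h1
    have h2 := ha T hT
    have h3 : r * m < r * (∑ i ∈ T, a i / r + 1) := by rw [mul_add]; omega
    exact Nat.lt_succ_iff.1 (Nat.lt_of_mul_lt_mul_left h3)
  obtain ⟨b, ⟨hb, hba⟩, hmin⟩ := (measure fun b : Fin n → ℕ => ∑ i, b i).wf.has_min _ hne
  refine ⟨b, hb, hba, ?_⟩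
  by_contra! hS
  obtain ⟨S, -, hSh⟩ := Finset.exists_subset_card_eq (s := (Finset.univ : Finset (Fin n)))
    (n := h) (by simpa using hhn)
  obtain ⟨t, -, ht⟩ : ∃ t ∈ S, b t ≠ 0 := by
    by_contra! h0
    have := hb S hSh
    rw [Finset.sum_eq_zero h0] at this
    omega
  obtain ⟨b', hb'⟩ : ∃ b', b = b' + Pi.single t 1 := by
    refine ⟨b - Pi.single t 1, (tsub_add_cancel_of_le fun i => ?_).symm⟩
    by_cases hi : i = t
    · subst hi
      simpa using Nat.one_le_iff_ne_zero.2 ht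
    · simp [hi]
  have hsum : ∀ T : Finset (Fin n), ∑ i ∈ T, b i = ∑ i ∈ T, b' i + if t ∈ T then 1 else 0 :=
    fun T => by
      rw [hb']
      simp only [Pi.add_apply, Finset.sum_add_distrib, Finset.sum_pi_single']
  refine hmin b' ⟨fun T hT => ?_, fun i => le_trans ?_ (hba i)⟩ ?_
  · have h1 := hb T hT
    have h2 := hS T hT
    have h3 := hsum T
    split_ifs at h3 <;> omega
  · rw [hb']
    simp [mul_add]
  · have h3 := hsum Finset.univ
    rw [if_pos (Finset.mem_univ t)] at h3
    change ∑ i, b' i < ∑ i, b i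
    omega

end MonomialFiltration

section SymbolicPowers

variable {R : Type*} [CommRing R] {n : ℕ}

/-- The defining ideal of the star configuration of codimension `h` of the family `F`. -/
def starConfigurationIdeal (F : Fin n → R) (h : ℕ) : Ideal R :=
  ⨅ (S : Finset (Fin n)) (_ : S.card = h), Ideal.span (F '' (S : Set (Fin n)))

theorem mem_starConfigurationIdeal {F : Fin n → R} {h : ℕ} {x : R} :
    x ∈ starConfigurationIdeal F h ↔
      ∀ S : Finset (Fin n), S.card = h → x ∈ Ideal.span (F '' (S : Set (Fin n))) := by
  simp [starConfigurationIdeal, Submodule.mem_iInf]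

theorem prod_compl_mem_span (F : Fin n → R) {S T : Finset (Fin n)} (hST : S.card = T.card)
    (hne : T ≠ S) : ∏ j ∈ Sᶜ, F j ∈ Ideal.span (F '' (T : Set (Fin n))) := by
  obtain ⟨j, hjT, hjS⟩ : ∃ j ∈ T, j ∉ S := by
    by_contra! hsub
    exact hne (Finset.eq_of_subset_of_card_le hsub hST.le)
  exact Ideal.mem_of_dvd _ (Finset.dvd_prod_of_mem F (Finset.mem_compl.2 hjS))
    (Ideal.subset_span ⟨j, hjT, rfl⟩)

theorem mul_prod_compl_mem_starConfigurationIdeal (F : Fin n → R) {h : ℕ} {S : Finset (Fin n)}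
    (hS : S.card = h) {x : R} (hx : x ∈ Ideal.span (F '' (S : Set (Fin n)))) :
    x * ∏ j ∈ Sᶜ, F j ∈ starConfigurationIdeal F h := by
  refine mem_starConfigurationIdeal.2 fun T hT => ?_
  by_cases hTS : T = S
  · subst hTS
    exact Ideal.mul_mem_right _ _ hx
  · exact Ideal.mul_mem_left _ _ (prod_compl_mem_span F (hS.trans hT.symm) hTS)

theorem exists_notMem_mul_mem_span_pow [IsNoetherianRing R] {F : Fin n → R} {h : ℕ}
    (hF : IsPermutableRegular F h) {M : ℕ} {f : R}
    (hf : f ∈ symbolicPower (starConfigurationIdeal F h) M) {S : Finset (Fin n)}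
    (hS : S.card = h) {z : R} (hz : z ∉ Ideal.span (F '' (S : Set (Fin n)))) :
    ∃ s, s * z ∉ Ideal.span (F '' (S : Set (Fin n))) ∧
      s * f ∈ Ideal.span (F '' (S : Set (Fin n))) ^ M := by
  set I := starConfigurationIdeal F h
  have hzI : z * ∏ j ∈ Sᶜ, F j ∉ I := fun hmem => hz <| by
    have h1 := mem_starConfigurationIdeal.1 hmem S hS
    rw [← powIdeal_one F (e := fun _ => 1) fun _ _ => rfl] at h1 ⊢
    refine hF.mem_powIdeal_of_prod_mul hS.le (fun _ _ => le_rfl) (fun _ => 1) Sᶜ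
      disjoint_compl_left ?_
    simpa [mul_comm] using h1
  obtain ⟨P, hP, hle⟩ := exists_le_isAssociatedPrime_of_isNoetherianRing R
    (Ideal.Quotient.mk I (z * ∏ j ∈ Sᶜ, F j)) fun h0 => hzI (Ideal.Quotient.eq_zero_iff_mem.1 h0)
  obtain ⟨s, hs, hsf⟩ := hf P hP
  refine ⟨s, fun hsz => hs (hle ?_), Ideal.pow_right_mono ?_ M hsf⟩
  · rw [Submodule.mem_colon_singleton, Submodule.mem_bot, Algebra.smul_def,
      Ideal.Quotient.algebraMap_eq, ← map_mul, Ideal.Quotient.eq_zero_iff_mem, ← mul_assoc]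
    exact mul_prod_compl_mem_starConfigurationIdeal F hS hsz
  · exact fun x hx => mem_starConfigurationIdeal.1 hx S hS

theorem symbolicPower_le_starIdeal [IsNoetherianRing R] {F : Fin n → R} {h : ℕ}
    (hF : IsPermutableRegular F h) (M : ℕ) :
    symbolicPower (starConfigurationIdeal F h) M ≤ starIdeal F h M :=
  fun _ hf => mem_starIdeal hF fun _ hS _ hz => exists_notMem_mul_mem_span_pow hF hf hS hz

theorem familyMonomial_mem_symbolicPower [IsNoetherianRing R] {F : Fin n → R} {h : ℕ}
    (hF : IsPermutableRegular F h) {m : ℕ} {a : Fin n → ℕ} (ha : a ∈ starExponents n h m) :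
    familyMonomial F a ∈ symbolicPower (starConfigurationIdeal F h) m := by
  intro P hP
  set I := starConfigurationIdeal F h
  obtain ⟨hPp, x, hx⟩ := isAssociatedPrime_iff.1 hP
  obtain ⟨x, rfl⟩ := Ideal.Quotient.mk_surjective x
  have hmem : ∀ s, s ∈ P ↔ s * x ∈ I := fun s => by
    rw [hx, Submodule.mem_colon_singleton, Submodule.mem_bot, Algebra.smul_def,
      Ideal.Quotient.algebraMap_eq, ← map_mul, Ideal.Quotient.eq_zero_iff_mem]
  have hxI : x ∉ I := fun h0 => hPp.ne_top ((Ideal.eq_top_iff_one P).2 ((hmem 1).2 (by simpa)))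
  obtain ⟨S, hS, hxS⟩ : ∃ S : Finset (Fin n), S.card = h ∧
      x ∉ Ideal.span (F '' (S : Set (Fin n))) := by
    by_contra! h0
    exact hxI (mem_starConfigurationIdeal.2 h0)
  have hPj : ∀ j ∈ Sᶜ, F j ∉ P := fun j hj hjP => hxS <|
    hF S hS.le j (Finset.mem_compl.1 hj) x (mem_starConfigurationIdeal.1 ((hmem _).1 hjP) S hS)
  have hQ : ∏ j ∈ Sᶜ, F j ∉ P := fun hmemP => by
    obtain ⟨j, hj, hjP⟩ := hPp.prod_mem_iff.1 hmemP
    exact hPj j hj hjP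
  refine ⟨(∏ j ∈ Sᶜ, F j) ^ ∑ i ∈ S, a i, fun hmemP => hQ (hPp.mem_of_pow_mem _ hmemP), ?_⟩
  rw [familyMonomial, ← Finset.prod_mul_prod_compl S, ← mul_assoc]
  refine Ideal.mul_mem_right _ _ (Ideal.pow_le_pow_right (ha S hS) ?_)
  rw [← Finset.prod_pow_eq_pow_sum, ← Finset.prod_pow_eq_pow_sum, ← Finset.prod_mul_distrib]
  refine Ideal.prod_mem_prod fun i hi => ?_
  rw [← mul_pow, mul_comm]
  exact Ideal.pow_mem_pow (mul_prod_compl_mem_starConfigurationIdeal F hS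
    (Ideal.subset_span ⟨i, hi, rfl⟩)) _

theorem familyMonomial_mem_pow {F : Fin n → R} {J : Ideal R} (hFJ : ∀ i, F i ∈ J)
    (a : Fin n → ℕ) : familyMonomial F a ∈ J ^ ∑ i, a i := by
  rw [familyMonomial, ← Finset.prod_pow_eq_pow_sum]
  exact Ideal.prod_mem_prod fun i _ => Ideal.pow_mem_pow (hFJ i) _

theorem symbolicPower_starConfigurationIdeal_le [IsNoetherianRing R] {F : Fin n → R} {h : ℕ}
    (hF : IsPermutableRegular F h) (hhn : h ≤ n) {J : Ideal R} (hFJ : ∀ i, F i ∈ J)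
    {m r M : ℕ} (hm : 1 ≤ m) (hr : 1 ≤ r) (hM : r * m + h * (r - 1) < M + r) :
    symbolicPower (starConfigurationIdeal F h) M ≤
      J ^ (M - r * m) * symbolicPower (starConfigurationIdeal F h) m ^ r := by
  refine (symbolicPower_le_starIdeal hF M).trans (Ideal.span_le.2 ?_)
  rintro _ ⟨a, ha, rfl⟩
  obtain ⟨b, hb, hba, S, hS, hSm⟩ := exists_starExponents_sum_eq hhn hm hr hM ha
  rw [← tsub_add_cancel_of_le hba, familyMonomial_add, familyMonomial_nsmul]
  refine Ideal.mul_mem_mul (Ideal.pow_le_pow_right ?_ (familyMonomial_mem_pow hFJ _))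
    (Ideal.pow_mem_pow (familyMonomial_mem_symbolicPower hF hb) r)
  have h1 : ∑ i ∈ S, (a - r • b) i + r * m = ∑ i ∈ S, a i := by
    rw [← hSm, Finset.mul_sum, ← Finset.sum_add_distrib]
    exact Finset.sum_congr rfl fun i _ => tsub_add_cancel_of_le (hba i)
  have h2 := Finset.sum_le_univ_sum_of_nonneg (s := S) (f := a - r • b) fun i => Nat.zero_le _
  have h3 := ha S hS
  omega

end SymbolicPowers

theorem isPermutableRegular_of_isRegular {R ι : Type*} [CommRing R] [DecidableEq ι] {F : ι → R}
    {h : ℕ} (H : ∀ l : List ι, l.Nodup → l.length ≤ h + 1 →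
      RingTheory.Sequence.IsRegular R (l.map F)) : IsPermutableRegular F h := by
  intro T hT j hj y hy
  have hreg := (H (T.toList ++ [j]) (by
    rw [List.nodup_append]
    refine ⟨T.nodup_toList, List.nodup_singleton j, ?_⟩
    intro a ha b hb hab
    rw [List.mem_singleton] at hb
    exact hj (hb ▸ hab ▸ Finset.mem_toList.1 ha)) (by simpa using hT)).toIsWeaklyRegular
  rw [List.map_append, RingTheory.Sequence.isWeaklyRegular_append_iff, List.map_singleton,
    RingTheory.Sequence.isWeaklyRegular_singleton_iff] at hreg
  have hspan : (Ideal.ofList (T.toList.map F) • ⊤ : Submodule R R) =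
      Ideal.span (F '' (T : Set ι)) := by
    rw [smul_eq_mul, Ideal.mul_top, Ideal.ofList]
    congr 1
    ext x
    simp
  have h2 := hreg.2
  rw [hspan] at h2
  rw [← Ideal.Quotient.eq_zero_iff_mem] at hy ⊢
  refine h2 ?_
  change F j • Ideal.Quotient.mk _ y = F j • 0
  rw [smul_zero, Algebra.smul_def, Ideal.Quotient.algebraMap_eq, ← map_mul, hy]

theorem MvPolynomial.IsHomogeneous.mem_span_range_X {σ k : Type*} [Field k]
    {p : MvPolynomial σ k} {d : ℕ} (hp : p.IsHomogeneous d) (hunit : ¬ IsUnit p) :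
    p ∈ Ideal.span (Set.range (MvPolynomial.X : σ → MvPolynomial σ k)) := by
  rw [← Set.image_univ, MvPolynomial.mem_ideal_span_X_image]
  intro u hu
  by_contra! h0
  have hu0 : u = 0 := Finsupp.ext fun i => h0 i (Set.mem_univ i)
  subst hu0
  rw [MvPolynomial.mem_support_iff] at hu
  have hd : d = 0 := by simpa using (hp hu).symm
  subst hd
  rw [MvPolynomial.totalDegree_eq_zero_iff_eq_C.1 (Nat.le_zero.1 hp.totalDegree_le)] at hunit
  exact hunit ((IsUnit.mk0 _ hu).map MvPolynomial.C)

/-- **Theorem `thm.StarConf`.** Let `I` be the defining ideal of a codimension `h` star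
configuration in `ℙ^N_k` given by homogeneous forms `F_1,…,F_n` any `h+1` of which form a
complete intersection (regular sequence).  Then for all `m, r, c ≥ 1`,
`I^{(r(m+h−1)−h+c)} ⊆ 𝔪^{(r−1)(h−1)+c−1} (I^{(m)})^r`. -/
theorem stmt_9 {k : Type*} [Field k] (N n h : ℕ) (hh : 1 ≤ h) (hhN : h ≤ N) (hhn : h ≤ n)
    (F : Fin n → MvPolynomial (Fin (N + 1)) k)
    (hFhom : ∀ i, ∃ d, MvPolynomial.IsHomogeneous (F i) d)
    (hCI : ∀ l : List (Fin n), l.Nodup → l.length ≤ h + 1 →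
      RingTheory.Sequence.IsRegular (MvPolynomial (Fin (N + 1)) k) (l.map F))
    (I : Ideal (MvPolynomial (Fin (N + 1)) k))
    (hI : I = ⨅ (S : Finset (Fin n)) (_ : S.card = h), Ideal.span (F '' ↑S)) :
    ∀ m r c : ℕ, 1 ≤ m → 1 ≤ r → 1 ≤ c →
      symbolicPower I (r * (m + h - 1) - h + c) ≤
        (Ideal.span (Set.range (MvPolynomial.X : Fin (N + 1) → MvPolynomial (Fin (N + 1)) k)))
            ^ ((r - 1) * (h - 1) + c - 1) * (symbolicPower I m) ^ r := by

  intro m r c hm hr hc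
  have hF : IsPermutableRegular F h := isPermutableRegular_of_isRegular hCI
  have hFJ : ∀ i, F i ∈ Ideal.span
      (Set.range (MvPolynomial.X : Fin (N + 1) → MvPolynomial (Fin (N + 1)) k)) := fun i => by
    obtain ⟨d, hd⟩ := hFhom i
    refine hd.mem_span_range_X fun hunit => ?_
    refine (hCI [i] (List.nodup_singleton i) (by simp)).top_ne_smul ?_
    rw [List.map_singleton, Ideal.ofList_singleton, Ideal.span_singleton_eq_top.2 hunit,
      smul_eq_mul, Ideal.top_mul]
  obtain ⟨r, rfl⟩ : ∃ r', r = r' + 1 := ⟨r - 1, by omega⟩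
  obtain ⟨h, rfl⟩ : ∃ h', h = h' + 1 := ⟨h - 1, by omega⟩
  have hM : (r + 1) * (m + (h + 1) - 1) - (h + 1) + c = (r + 1) * m + r * h + c - 1 := by
    rw [← Nat.add_assoc, Nat.add_sub_cancel]
    have h1 : (r + 1) * (m + h) = (r + 1) * m + r * h + h := by ring
    have h2 : 1 ≤ (r + 1) * m := Nat.mul_pos r.succ_pos hm
    omega
  have key := symbolicPower_starConfigurationIdeal_le hF hhn hFJ hm hr
    (M := (r + 1) * m + r * h + c - 1) (by
      rw [Nat.add_sub_cancel, Nat.succ_mul, Nat.mul_comm (h + 1) r, Nat.mul_succ]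
      omega)
  have ht : (r + 1) * m + r * h + c - 1 - (r + 1) * m = (r + 1 - 1) * (h + 1 - 1) + c - 1 := by
    simp only [Nat.add_sub_cancel]
    omega
  rw [hI, hM, ← ht]
  exact key
end
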